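/- Let X ⊆ A^ℤ be a subshift with zero entropy and let E ⊆ X² be a closed doubly shift-invariant symmetric reflexive relation. Then there exists a finite alphabet Â containing A and a subshift Y with X ⊆ Y ⊆ Â^ℤ such that EP(Y)^(λ) ∩ X² = E^(λ) for all ordinals λ. Furthermore, if E^(λ) = X² for some ordinal λ, then EP(Y)^(λ+1) = Y², and moreover EP(Y)^(λ) = Y² provided either λ is even, or λ is odd and for every k ≥ 1, (E^[k])² is contained in the closure of (E^(λ-1))^[2k] ∩ (E^[k])². -/

import Mathlib

open Filter Topology Set

namespace CPE

universe u

/-- The left shift map on bi-infinite sequences: `(σ x) i = x (i+1)`. -/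
def shiftMap {A : Type*} (x : ℤ → A) : ℤ → A := fun i => x (i + 1)

/-- The shift by `m`: `(σ^m x) i = x (i + m)`. -/
def shiftZ {A : Type*} (m : ℤ) (x : ℤ → A) : ℤ → A := fun i => x (i + m)

/-- A subshift: a closed shift-invariant subset of the full shift. -/
def IsSubshift {A : Type*} [TopologicalSpace A] (X : Set (ℤ → A)) : Prop :=
  IsClosed X ∧ shiftMap '' X = X

/-- The orbit closure of a point. -/
def orbitClosure {A : Type*} [TopologicalSpace A] (x : ℤ → A) : Set (ℤ → A) :=
  closure {y | ∃ m : ℤ, y = shiftZ m x}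

/-- A Toeplitz point: every coordinate repeats along some arithmetic progression. -/
def IsToeplitz {A : Type*} (x : ℤ → A) : Prop :=
  ∀ i : ℤ, ∃ n : ℕ, 0 < n ∧ ∀ m : ℤ, x (i + m * n) = x i

/-- A minimal subshift: a nonempty subshift with no nonempty proper subshift. -/
def IsMinimalSubshift {A : Type*} [TopologicalSpace A] (M : Set (ℤ → A)) : Prop :=
  IsSubshift M ∧ M.Nonempty ∧ ∀ M' ⊆ M, IsSubshift M' → M'.Nonempty → M' = M

/-- The words of length `n` appearing in points of `X`. -/
def lang {A : Type*} (X : Set (ℤ → A)) (n : ℕ) : Set (Fin n → A) :=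
  {w | ∃ x ∈ X, ∀ i : Fin n, x (i : ℤ) = w i}

/-- `X` has zero (topological) entropy: `lim (log |L_n(X)|)/n = 0`. -/
def HasZeroEntropy {A : Type*} (X : Set (ℤ → A)) : Prop :=
  Tendsto (fun n : ℕ => Real.log ((lang X n).ncard) / n) atTop (nhds 0)

/-- `N(𝒰 ∨ σ⁻¹𝒰 ∨ ⋯ ∨ σ^{-(n-1)}𝒰)` for the two-element cover `𝒰 = (C0, C1)`:
the minimal number of sets of the form `⋂_{i<n} σ^{-i} C_{u i}` needed to cover `X`. -/
noncomputable def coverNum {A : Type*} (X C0 C1 : Set (ℤ → A)) (n : ℕ) : ℕ :=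
  sInf {m | ∃ S : Finset (Fin n → Bool), S.card = m ∧
    X ⊆ ⋃ u ∈ S, ⋂ i : Fin n, shiftMap^[(i : ℕ)] ⁻¹' (if u i then C1 else C0)}

/-- The topological entropy `h(𝒰)` of the two-element cover `𝒰 = (C0, C1)` of a subshift `X`.
By subadditivity (Fekete's lemma) the limit `lim_n (1/n) log N_n` exists and equals the
infimum `⨅_{n ≥ 1} (1/n) log N_n`, which we use as the definition. -/
noncomputable def coverEntropy {A : Type*} (X C0 C1 : Set (ℤ → A)) : ℝ :=
  ⨅ n : ℕ, Real.log (coverNum X C0 C1 (n + 1)) / (n + 1)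

/-- `(x, y)` is an entropy pair of the subshift `X`: `x ≠ y` and for all disjoint closed
neighborhoods `U` of `x` and `V` of `y` (in `X`), the cover `(Uᶜ, Vᶜ)` has positive entropy. -/
def IsEntropyPair {A : Type*} [TopologicalSpace A] (X : Set (ℤ → A)) (x y : ℤ → A) : Prop :=
  x ∈ X ∧ y ∈ X ∧ x ≠ y ∧
    ∀ U V : Set (ℤ → A), IsClosed U → IsClosed V → U ∈ nhdsWithin x X → V ∈ nhdsWithin y X →
      Disjoint U V → 0 < coverEntropy X Uᶜ Vᶜ

/-- `EP(X)`: the entropy pairs of `X` together with the diagonal on `X`. -/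
def EP {A : Type*} [TopologicalSpace A] (X : Set (ℤ → A)) : Set ((ℤ → A) × (ℤ → A)) :=
  {p | IsEntropyPair X p.1 p.2} ∪ {p | p.1 ∈ X ∧ p.1 = p.2}

/-- The close-up process on a relation `E`: `E^(0) = E`; at a successor step `α + 1` one takes
the topological closure if `α + 1` is odd (i.e. `α` is even), and the transitive closure if
`α + 1` is even (i.e. `α` is odd); at limit steps one takes the union.  (An ordinal is even
iff it is of the form `λ + 2n` with `λ` a limit ordinal and `n ∈ ℕ`, iff its residue mod `2`
is `0`.)  When `E` is closed this agrees with the process of Barbieri–García-Ramos started at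
`E^(1) = E`, since then `E^(1) = closure E = E`. -/
noncomputable def closeUp {α : Type u} [TopologicalSpace α] (E : Set (α × α))
    (o : Ordinal.{u}) : Set (α × α) :=
  Ordinal.limitRecOn o E
    (fun β ih => if β % 2 = 0 then closure ih
      else {p | Relation.TransGen (fun a b => (a, b) ∈ ih) p.1 p.2})
    (fun β _ ih => ⋃ γ : Set.Iio β, ih γ.1 γ.2)

/-- The close-up rank of `E`: the least ordinal `λ` (with `λ ≥ 1` if `E` is closed, matching
the convention `E^(ζ) = E`, `ζ = 1` for closed `E`) such that `E^(λ) = E^(λ+1)`. -/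
noncomputable def closeUpRank {α : Type u} [TopologicalSpace α] (E : Set (α × α)) :
    Ordinal.{u} :=
  sInf {o | (IsClosed E → 1 ≤ o) ∧ closeUp E o = closeUp E (o + 1)}

/-- `E^[k] = {(x₁, …, x_k) : ∀ i j, (x_i, x_j) ∈ E}`. -/
def relPow {α : Type*} (E : Set (α × α)) (k : ℕ) : Set (Fin k → α) :=
  {v | ∀ i j, (v i, v j) ∈ E}

/-- `(E^[k])²` viewed inside `α^{k+k}` via concatenation of the two `k`-tuples. -/
def pairSet {α : Type*} (E : Set (α × α)) (k : ℕ) : Set (Fin (k + k) → α) :=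
  {w | ∃ u ∈ relPow E k, ∃ v ∈ relPow E k, w = Fin.append u v}

end CPE

namespace CPE

/-- The embedding `A^ℤ → (A ⊕ Fin m)^ℤ` induced by the inclusion of `A` into the larger
alphabet `Â = A ⊕ Fin m`. -/
def inlMap {A : Type*} (m : ℕ) (x : ℤ → A) : ℤ → A ⊕ Fin m := fun i => Sum.inl (x i)

end CPE

namespace CPE

universe u

section Parity

theorem ordinal_mod_two (o : Ordinal.{u}) : o % 2 = 0 ∨ o % 2 = 1 := by
  have h : o % 2 < 2 := Ordinal.mod_lt o two_ne_zero
  have h1 : o % 2 < 1 + 1 := by rwa [one_add_one_eq_two]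
  rcases (Order.le_of_lt_add_one h1).lt_or_eq with h2 | h2
  · left; exact Order.lt_one_iff.1 h2
  · right; exact h2

theorem add_one_mod_two_of_even {o : Ordinal.{u}} (h : o % 2 = 0) : (o + 1) % 2 = 1 := by
  have h1 := Ordinal.div_add_mod o 2
  rw [h, add_zero] at h1
  rw [← h1, Ordinal.mul_add_mod_self]
  exact Ordinal.mod_eq_of_lt (by rw [← one_add_one_eq_two]; exact Order.lt_succ 1)

theorem add_one_mod_two_of_odd {o : Ordinal.{u}} (h : o % 2 = 1) : (o + 1) % 2 = 0 := by
  have h1 := Ordinal.div_add_mod o 2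
  rw [h] at h1
  have h2 : o + 1 = 2 * (o / 2 + 1) := by
    rw [mul_add, mul_one, ← one_add_one_eq_two, ← add_assoc, one_add_one_eq_two, h1]
  rw [h2, Ordinal.mul_mod]

theorem mod_two_of_isSuccLimit {o : Ordinal.{u}} (h : Order.IsSuccLimit o) : o % 2 = 0 := by
  rcases ordinal_mod_two o with h1 | h1
  · exact h1
  · have h2 := Ordinal.div_add_mod o 2
    rw [h1] at h2
    rw [← h2] at h
    exact absurd h (Order.not_isSuccLimit_succ _)

end Parity

section CloseUp

variable {α : Type u} [TopologicalSpace α]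

/-- The transitive closure of a relation given as a set of pairs. -/
def transClosure {α : Type*} (S : Set (α × α)) : Set (α × α) :=
  {p | Relation.TransGen (fun a b => (a, b) ∈ S) p.1 p.2}

theorem subset_transClosure {α : Type*} (S : Set (α × α)) : S ⊆ transClosure S :=
  fun _ hp => Relation.TransGen.single hp

theorem transClosure_trans {α : Type*} {S : Set (α × α)} {a b c : α}
    (hab : (a, b) ∈ transClosure S) (hbc : (b, c) ∈ transClosure S) :
    (a, c) ∈ transClosure S :=
  Relation.TransGen.trans (r := fun a b => (a, b) ∈ S) hab hbc

theorem transClosure_mono {α : Type*} {S T : Set (α × α)} (h : S ⊆ T) :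
    transClosure S ⊆ transClosure T :=
  fun p hp => Relation.TransGen.mono (fun _ _ hab => h hab) p.1 p.2 hp

theorem transClosure_subset_prod {α : Type*} {S : Set (α × α)} {X : Set α} (h : S ⊆ X ×ˢ X) :
    transClosure S ⊆ X ×ˢ X := by
  rintro ⟨a, b⟩ hp
  change Relation.TransGen _ a b at hp
  induction hp with
  | single hab => exact h hab
  | tail _ hbc ih => exact ⟨ih.1, (h hbc).2⟩

theorem closeUp_zero (E : Set (α × α)) : closeUp E 0 = E := by
  unfold closeUp; rw [Ordinal.limitRecOn_zero]

theorem closeUp_add_one_of_even (E : Set (α × α)) {o : Ordinal.{u}} (h : o % 2 = 0) :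
    closeUp E (o + 1) = closure (closeUp E o) := by
  unfold closeUp; rw [Ordinal.limitRecOn_add_one, if_pos h]

theorem closeUp_add_one_of_odd (E : Set (α × α)) {o : Ordinal.{u}} (h : o % 2 = 1) :
    closeUp E (o + 1) = transClosure (closeUp E o) := by
  unfold closeUp; rw [Ordinal.limitRecOn_add_one, if_neg (by rw [h]; exact one_ne_zero)]; rfl

theorem closeUp_limit (E : Set (α × α)) {o : Ordinal.{u}} (h : Order.IsSuccLimit o) :
    closeUp E o = ⋃ γ : Set.Iio o, closeUp E γ.1 := by
  unfold closeUp; rw [Ordinal.limitRecOn_limit _ _ _ _ h]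

theorem closeUp_subset_add_one (E : Set (α × α)) (o : Ordinal.{u}) :
    closeUp E o ⊆ closeUp E (o + 1) := by
  rcases ordinal_mod_two o with h | h
  · rw [closeUp_add_one_of_even E h]; exact subset_closure
  · rw [closeUp_add_one_of_odd E h]; exact subset_transClosure _

theorem closeUp_mono (E : Set (α × α)) {a b : Ordinal.{u}} (hab : a ≤ b) :
    closeUp E a ⊆ closeUp E b := by
  induction b using Ordinal.limitRecOn with
  | zero => rw [nonpos_iff_eq_zero.1 hab]
  | add_one b ih =>
    rcases hab.lt_or_eq with h | h
    · exact (ih (Order.le_of_lt_succ h)).trans (closeUp_subset_add_one E b)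
    · rw [h]
  | limit b hb ih =>
    rcases hab.lt_or_eq with h | h
    · rw [closeUp_limit E hb]
      exact subset_iUnion (fun γ : Set.Iio b => closeUp E γ.1) ⟨a, h⟩
    · rw [h]

theorem closeUp_subset_prod {E : Set (α × α)} {X : Set α} (hX : IsClosed X) (h : E ⊆ X ×ˢ X)
    (o : Ordinal.{u}) : closeUp E o ⊆ X ×ˢ X := by
  induction o using Ordinal.limitRecOn with
  | zero => rwa [closeUp_zero]
  | add_one b ih =>
    rcases ordinal_mod_two b with hb | hb
    · rw [closeUp_add_one_of_even E hb]
      exact closure_minimal ih (hX.prod hX)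
    · rw [closeUp_add_one_of_odd E hb]
      exact transClosure_subset_prod ih
  | limit b hb ih =>
    rw [closeUp_limit E hb]
    exact iUnion_subset fun γ => ih γ.1 γ.2

theorem transClosure_closeUp_subset (E : Set (α × α)) (o : Ordinal.{u}) :
    transClosure (closeUp E o) ⊆ closeUp E (o + 1 + 1) := by
  rcases ordinal_mod_two o with h | h
  · rw [closeUp_add_one_of_odd E (add_one_mod_two_of_even h)]
    exact transClosure_mono (closeUp_subset_add_one E o)
  · rw [← closeUp_add_one_of_odd E h]
    exact closeUp_subset_add_one E _

/-- Past stage `0`, the even stages of the close-up process are transitive relations. -/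
theorem transClosure_closeUp_of_even (E : Set (α × α)) {o : Ordinal.{u}} (h : o % 2 = 0)
    (h0 : o ≠ 0) : transClosure (closeUp E o) ⊆ closeUp E o := by
  rintro ⟨a, b⟩ hp
  change Relation.TransGen _ a b at hp
  induction hp with
  | single hab => exact hab
  | @tail b c _ hbc ih =>
    induction o using Ordinal.limitRecOn with
    | zero => exact absurd rfl h0
    | add_one o _ =>
      have ho : o % 2 = 1 := by
        rcases ordinal_mod_two o with h1 | h1
        · rw [add_one_mod_two_of_even h1] at h; exact absurd h one_ne_zero
        · exact h1
      rw [closeUp_add_one_of_odd E ho] at *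
      exact transClosure_trans ih hbc
    | limit o ho _ =>
      rw [closeUp_limit E ho, mem_iUnion] at ih hbc
      obtain ⟨⟨γ, hγ⟩, ih⟩ := ih
      obtain ⟨⟨δ, hδ⟩, hbc⟩ := hbc
      have hm : max γ δ < o := max_lt hγ hδ
      have h1 := ho.succ_lt (ho.succ_lt hm)
      refine closeUp_mono E h1.le (transClosure_closeUp_subset E (max γ δ) ?_)
      exact transClosure_trans
        (subset_transClosure _ (closeUp_mono E (le_max_left γ δ) ih))
        (subset_transClosure _ (closeUp_mono E (le_max_right γ δ) hbc))

theorem closeUp_trans_of_even {E : Set (α × α)} {o : Ordinal.{u}} (h : o % 2 = 0)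
    (h0 : o ≠ 0) {a b c : α} (hab : (a, b) ∈ closeUp E o) (hbc : (b, c) ∈ closeUp E o) :
    (a, c) ∈ closeUp E o :=
  transClosure_closeUp_of_even E h h0
    (transClosure_trans (subset_transClosure _ hab) (subset_transClosure _ hbc))

/-- A continuous map that sends `E` into `F` sends each stage of the close-up process of `E`
into the corresponding stage for `F`. -/
theorem closeUp_map {β : Type u} [TopologicalSpace β] {E : Set (α × α)} {F : Set (β × β)}
    {f : α → β} (hf : Continuous f) (h : ∀ p ∈ E, Prod.map f f p ∈ F) (o : Ordinal.{u}) :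
    ∀ p ∈ closeUp E o, Prod.map f f p ∈ closeUp F o := by
  induction o using Ordinal.limitRecOn with
  | zero => rwa [closeUp_zero, closeUp_zero]
  | add_one b ih =>
    rcases ordinal_mod_two b with hb | hb
    · rw [closeUp_add_one_of_even E hb, closeUp_add_one_of_even F hb]
      intro p hp
      exact map_mem_closure (hf.prodMap hf) hp ih
    · rw [closeUp_add_one_of_odd E hb, closeUp_add_one_of_odd F hb]
      rintro ⟨a, b⟩ hp
      change Relation.TransGen _ a b at hp
      induction hp with
      | single hab => exact Relation.TransGen.single (ih _ hab)
      | tail _ hbc ih' => exact Relation.TransGen.tail ih' (ih _ hbc)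
  | limit b hb ih =>
    rw [closeUp_limit E hb, closeUp_limit F hb]
    intro p hp
    obtain ⟨γ, hγ⟩ := mem_iUnion.1 hp
    exact mem_iUnion.2 ⟨γ, ih γ.1 γ.2 p hγ⟩

end CloseUp

section Agreement

variable {D : Type*} [TopologicalSpace D]

theorem tendsto_of_agree {s : ℕ → ℤ → D} {x : ℤ → D}
    (h : ∀ (m : ℕ) (i : ℤ), |i| ≤ m → s m i = x i) : Tendsto s atTop (𝓝 x) := by
  rw [tendsto_pi_nhds]
  intro i
  refine tendsto_const_nhds.congr' ?_
  filter_upwards [eventually_ge_atTop i.natAbs] with m hm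
  exact (h m i (by rw [Int.abs_eq_natAbs]; omega)).symm

theorem mem_closure_of_agree {S : Set ((ℤ → D) × (ℤ → D))} {x x' : ℤ → D}
    (h : ∀ m : ℕ, ∃ p ∈ S, ∀ i : ℤ, |i| ≤ m → p.1 i = x i ∧ p.2 i = x' i) :
    (x, x') ∈ closure S := by
  choose p hp hpx using h
  exact mem_closure_of_tendsto
    ((tendsto_of_agree fun m i hi => (hpx m i hi).1).prodMk_nhds
      (tendsto_of_agree fun m i hi => (hpx m i hi).2)) (Eventually.of_forall hp)

theorem exists_agree_mem {Y U : Set (ℤ → D)} {x : ℤ → D} (hU : U ∈ 𝓝[Y] x) :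
    ∃ N : ℕ, ∀ y ∈ Y, (∀ i : ℤ, |i| ≤ N → y i = x i) → y ∈ U := by
  by_contra! hc
  choose s hsY hsx hsU using hc
  have ht : Tendsto s atTop (𝓝[Y] x) :=
    tendsto_nhdsWithin_iff.2 ⟨tendsto_of_agree hsx, Eventually.of_forall hsY⟩
  obtain ⟨N, hN⟩ := (ht.eventually hU).exists
  exact hsU N hN

theorem isClopen_coord [DiscreteTopology D] (i : ℤ) (S : Set D) : IsClopen {y : ℤ → D | y i ∈ S} :=
  (isClopen_discrete S).preimage (continuous_apply i)

end Agreement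

theorem shiftMap_iterate {D : Type*} (n : ℕ) (z : ℤ → D) :
    shiftMap^[n] z = shiftZ n z := by
  induction n with
  | zero => funext i; simp [shiftZ]
  | succ n ih =>
    rw [Function.iterate_succ_apply', ih]
    funext i
    simp only [shiftMap, shiftZ]
    congr 1; push_cast; ring

theorem continuous_shiftZ {D : Type*} [TopologicalSpace D] (s : ℤ) :
    Continuous (shiftZ s : (ℤ → D) → ℤ → D) :=
  continuous_pi fun i => continuous_apply (i + s)

theorem shiftZ_zero {D : Type*} (x : ℤ → D) : shiftZ 0 x = x := by
  funext i; simp [shiftZ]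

section Entropy

variable {D : Type*}

theorem coverNum_spec (Y C0 C1 : Set (ℤ → D)) (hC : C0 ∪ C1 = univ) (n : ℕ) :
    ∃ S : Finset (Fin n → Bool), S.card = coverNum Y C0 C1 n ∧
      Y ⊆ ⋃ u ∈ S, ⋂ i : Fin n, shiftMap^[(i : ℕ)] ⁻¹' (if u i then C1 else C0) := by
  classical
  refine Nat.sInf_mem (s := {m | ∃ S : Finset (Fin n → Bool), S.card = m ∧
    Y ⊆ ⋃ u ∈ S, ⋂ i : Fin n, shiftMap^[(i : ℕ)] ⁻¹' (if u i then C1 else C0)})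
    ⟨_, Finset.univ, rfl, ?_⟩
  intro z _
  simp only [mem_iUnion, mem_iInter]
  refine ⟨fun i => decide (shiftMap^[(i : ℕ)] z ∈ C1), Finset.mem_univ _, fun i => ?_⟩
  by_cases h : shiftMap^[(i : ℕ)] z ∈ C1
  · simp [h]
  · have h0 : shiftMap^[(i : ℕ)] z ∈ C0 := by
      have := mem_univ (shiftMap^[(i : ℕ)] z)
      rw [← hC] at this
      exact this.resolve_right h
    simpa [h] using h0

theorem bddBelow_coverEntropy (Y C0 C1 : Set (ℤ → D)) :
    BddBelow (range fun n : ℕ => Real.log (coverNum Y C0 C1 (n + 1)) / ((n : ℝ) + 1)) :=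
  ⟨0, by
    rintro _ ⟨n, rfl⟩
    exact div_nonneg (Real.log_natCast_nonneg _) (by positivity)⟩

/-- If each orbit stays inside one of the two sets, the cover has no entropy. -/
theorem coverEntropy_nonpos {Y C0 C1 : Set (ℤ → D)}
    (h : ∀ z ∈ Y, (∀ n : ℕ, shiftMap^[n] z ∈ C0) ∨ ∀ n : ℕ, shiftMap^[n] z ∈ C1) :
    coverEntropy Y C0 C1 ≤ 0 := by
  classical
  have hN : ∀ n, coverNum Y C0 C1 n ≤ 2 := by
    intro n
    let S : Finset (Fin n → Bool) := {fun _ => false, fun _ => true}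
    have h1 : coverNum Y C0 C1 n ≤ S.card := by
      refine Nat.sInf_le ⟨S, rfl, ?_⟩
      intro z hz
      simp only [mem_iUnion, mem_iInter]
      rcases h z hz with h0 | h0
      · exact ⟨fun _ => false, by simp [S], fun i => by simpa using h0 i⟩
      · exact ⟨fun _ => true, by simp [S], fun i => by simpa using h0 i⟩
    exact h1.trans Finset.card_le_two
  have hle : ∀ n : ℕ, coverEntropy Y C0 C1 ≤ Real.log 2 / ((n : ℝ) + 1) := by
    intro n
    refine (ciInf_le (bddBelow_coverEntropy Y C0 C1) n).trans ?_
    refine div_le_div_of_nonneg_right ?_ (by positivity)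
    rcases Nat.eq_zero_or_pos (coverNum Y C0 C1 (n + 1)) with h0 | h0
    · rw [h0]; simpa using Real.log_nonneg one_le_two
    · exact Real.log_le_log (by exact_mod_cast h0) (by exact_mod_cast hN (n + 1))
  have ht : Tendsto (fun n : ℕ => Real.log 2 / ((n : ℝ) + 1)) atTop (𝓝 0) :=
    tendsto_const_div_atTop_nhds_zero_nat (Real.log 2) |>.comp (tendsto_add_atTop_nat 1) |>.congr
      fun n => by simp
  exact ge_of_tendsto' ht hle

/-- Independence of `U` and `V` along a set of times of positive density gives positive entropy
of the cover by the complements. -/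
theorem coverEntropy_pos {Y U V : Set (ℤ → D)} (hUV : Disjoint U V) {L : ℕ} (hL : 0 < L)
    (h : ∀ n : ℕ, ∃ G : Finset ℕ, (∀ k ∈ G, k * L ≤ n) ∧ n + 1 ≤ 2 * L * G.card ∧
      ∀ ε : ℕ → Bool, ∃ z ∈ Y, ∀ k ∈ G, shiftMap^[k * L] z ∈ if ε k then V else U) :
    0 < coverEntropy Y Uᶜ Vᶜ := by
  classical
  have hpos : 0 < Real.log 2 / (2 * L) := by
    have := Real.log_pos one_lt_two
    positivity
  refine hpos.trans_le (le_ciInf fun n => ?_)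
  obtain ⟨G, hG, hcard, hz⟩ := h n
  have hC : Uᶜ ∪ Vᶜ = univ := by rw [← compl_inter, hUV.inter_eq, compl_empty]
  obtain ⟨S, hS, hcov⟩ := coverNum_spec Y Uᶜ Vᶜ hC (n + 1)
  have key : ∀ T ∈ G.powerset, ∃ u ∈ S, ∀ k (hk : k ∈ G),
      u ⟨k * L, Nat.lt_succ_of_le (hG k hk)⟩ = true ↔ k ∉ T := by
    intro T _
    obtain ⟨z, hzY, hzk⟩ := hz fun k => decide (k ∈ T)
    have h1 := hcov hzY
    simp only [mem_iUnion, mem_iInter] at h1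
    obtain ⟨u, huS, hu⟩ := h1
    refine ⟨u, huS, fun k hk => ?_⟩
    have h2 := hu ⟨k * L, Nat.lt_succ_of_le (hG k hk)⟩
    have h3 := hzk k hk
    rw [mem_preimage] at h2
    by_cases hkT : k ∈ T
    · simp only [hkT, decide_true, if_true] at h3
      simp only [hkT, not_true_eq_false, iff_false]
      intro hu1
      rw [hu1] at h2
      exact h2 h3
    · simp only [hkT, decide_false, Bool.false_eq_true, if_false] at h3
      simp only [hkT, not_false_eq_true, iff_true]
      by_contra hu1
      rw [if_neg hu1] at h2
      exact h2 h3
  choose! u huS hu using key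
  have hinj : Set.InjOn u (G.powerset : Set (Finset ℕ)) := by
    intro T hT T' hT' hTT
    have hT1 := Finset.mem_powerset.1 (Finset.mem_coe.1 hT)
    have hT2 := Finset.mem_powerset.1 (Finset.mem_coe.1 hT')
    ext k
    by_cases hk : k ∈ G
    · have h1 := hu T hT k hk
      have h2 := hu T' hT' k hk
      rw [hTT] at h1
      exact not_iff_not.1 (h1.symm.trans h2)
    · exact ⟨fun h => absurd (hT1 h) hk, fun h => absurd (hT2 h) hk⟩
  have hle : 2 ^ G.card ≤ coverNum Y Uᶜ Vᶜ (n + 1) := by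
    rw [← hS, ← Finset.card_powerset]
    exact Finset.card_le_card_of_injOn u (fun T hT => huS T hT) hinj
  have hlog : (G.card : ℝ) * Real.log 2 ≤ Real.log (coverNum Y Uᶜ Vᶜ (n + 1)) := by
    rw [← Real.log_pow]
    exact Real.log_le_log (by positivity) (by exact_mod_cast hle)
  rw [div_le_div_iff₀ (by positivity) (by positivity)]
  have hcard' : ((n : ℝ) + 1) ≤ 2 * L * G.card := by exact_mod_cast hcard
  have h2 := Real.log_pos one_lt_two
  calc Real.log 2 * ((n : ℝ) + 1) ≤ Real.log 2 * (2 * L * G.card) := by gcongr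
    _ = (G.card * Real.log 2) * (2 * L) := by ring
    _ ≤ _ := by gcongr

theorem isClosed_EP [TopologicalSpace D] [DiscreteTopology D] {Y : Set (ℤ → D)}
    (hY : IsClosed Y) : IsClosed (EP Y) := by
  rw [← closure_subset_iff_isClosed]
  rintro ⟨x, y⟩ hxy
  have hsub : EP Y ⊆ Y ×ˢ Y := by
    rintro ⟨a, b⟩ (h | h)
    · exact ⟨h.1, h.2.1⟩
    · have h2 : a = b := h.2
      exact ⟨h.1, h2 ▸ h.1⟩
  have hm : (x, y) ∈ Y ×ˢ Y := closure_minimal hsub (hY.prod hY) hxy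
  by_cases hne : x = y
  · exact Or.inr ⟨hm.1, hne⟩
  refine Or.inl ⟨hm.1, hm.2, hne, fun U V hU hV hUx hVy hUV => ?_⟩
  have h1 : ∀ᶠ z in 𝓝[Y] x, U ∈ 𝓝[Y] z := eventually_eventually_nhdsWithin.2 hUx
  have h2 : ∀ᶠ z in 𝓝[Y] y, V ∈ 𝓝[Y] z := eventually_eventually_nhdsWithin.2 hVy
  have h3 : ∀ᶠ p in 𝓝[Y ×ˢ Y] (x, y), U ∈ 𝓝[Y] p.1 ∧ V ∈ 𝓝[Y] p.2 := by
    rw [nhdsWithin_prod_eq]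
    exact h1.prod_mk h2
  rw [eventually_nhdsWithin_iff] at h3
  obtain ⟨⟨a, b⟩, hab, habE⟩ := (mem_closure_iff_frequently.1 hxy).and_eventually h3 |>.exists
  have hmab := hsub hab
  obtain ⟨haU, hbV⟩ := habE hmab
  have haU' : a ∈ U := mem_of_mem_nhdsWithin hmab.1 haU
  have hbV' : b ∈ V := mem_of_mem_nhdsWithin hmab.2 hbV
  rcases hab with hab | hab
  · exact hab.2.2.2 U V hU hV haU hbV hUV
  · have hab' : a = b := hab.2
    exact absurd (hab' ▸ hbV') (disjoint_left.1 hUV haU')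

end Entropy

/-- Every window of this length contains a hole-free run of length `m` in every shape. -/
def runBound (m : ℕ) : ℕ := 17 * m * 8 ^ m + 1

/-- A shape prescribes, for each coordinate, either a hole or a coordinate of one of the
members of a sequence of points, reading consecutive coordinates as long as it meets no hole. -/
structure IsShape (θ : ℤ → Option (ℕ × ℤ)) : Prop where
  compat : ∀ i p q, θ i = some p → θ (i + 1) = some q → q = (p.1, p.2 + 1)
  runs : ∀ (m : ℕ) (w : ℤ), ∃ s, w ≤ s ∧ s + m ≤ w + runBound m ∧
    ∀ i, s ≤ i → i < s + m → θ i ≠ none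
  tail : ∃ N : ℕ, ∀ i : ℤ, N < |i| → θ i ≠ none
  bound : ∃ k : ℕ, ∀ i p, θ i = some p → p.1 < k

theorem isShape_of_forall_some {θ : ℤ → Option (ℕ × ℤ)} (j : ℕ) (t : ℤ)
    (h : ∀ i, θ i = some (j, i + t)) : IsShape θ where
  compat i p q hp hq := by
    rw [h] at hp hq
    obtain rfl := Option.some.inj hp
    obtain rfl := Option.some.inj hq
    simp only [Prod.mk.injEq, true_and]; ring
  runs m w := ⟨w, le_rfl, by
    have : m ≤ runBound m := by
      unfold runBound
      nlinarith [Nat.one_le_pow m 8 (by norm_num)]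
    exact_mod_cast add_le_add_right (Nat.cast_le.2 this) w, fun i _ _ => by simp [h]⟩
  tail := ⟨0, fun i _ => by simp [h]⟩
  bound := ⟨j + 1, fun i p hp => by
    rw [h] at hp
    obtain rfl := Option.some.inj hp
    exact Nat.lt_succ_self j⟩

theorem IsShape.shift {θ : ℤ → Option (ℕ × ℤ)} (hθ : IsShape θ) (t : ℤ) :
    IsShape fun i => θ (i + t) where
  compat i p q hp hq := hθ.compat (i + t) p q hp (by rwa [add_right_comm] at hq)
  runs m w := by
    obtain ⟨s, h1, h2, h3⟩ := hθ.runs m (w + t)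
    exact ⟨s - t, by omega, by omega, fun i hi hi' => h3 _ (by omega) (by omega)⟩
  tail := by
    obtain ⟨N, hN⟩ := hθ.tail
    refine ⟨N + t.natAbs, fun i hi => hN _ ?_⟩
    rw [Int.abs_eq_natAbs] at hi ⊢
    omega
  bound := by
    obtain ⟨k, hk⟩ := hθ.bound
    exact ⟨k, fun i p hp => hk _ p hp⟩

theorem IsShape.reindex {θ : ℤ → Option (ℕ × ℤ)} (hθ : IsShape θ) (g : ℕ → ℕ) :
    IsShape fun i => (θ i).map (Prod.map g id) where
  compat i p q hp hq := by
    obtain ⟨p', hp', rfl⟩ := Option.map_eq_some_iff.1 hp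
    obtain ⟨q', hq', rfl⟩ := Option.map_eq_some_iff.1 hq
    rw [hθ.compat i p' q' hp' hq']
    rfl
  runs m w := by
    obtain ⟨s, h1, h2, h3⟩ := hθ.runs m w
    exact ⟨s, h1, h2, fun i hi hi' h => h3 i hi hi' (Option.map_eq_none_iff.1 h)⟩
  tail := by
    obtain ⟨N, hN⟩ := hθ.tail
    exact ⟨N, fun i hi h => hN i hi (Option.map_eq_none_iff.1 h)⟩
  bound := by
    obtain ⟨k, hk⟩ := hθ.bound
    refine ⟨(Finset.range k).sup g + 1, fun i p hp => ?_⟩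
    obtain ⟨p', hp', rfl⟩ := Option.map_eq_some_iff.1 hp
    exact Nat.lt_succ_of_le (Finset.le_sup (f := g) (Finset.mem_range.2 (hk i p' hp')))

theorem IsShape.eq_some_add {θ : ℤ → Option (ℕ × ℤ)} (hθ : IsShape θ) {s : ℤ} {m : ℕ}
    (h : ∀ i, s ≤ i → i < s + m → θ i ≠ none) {p : ℕ × ℤ} (hp : θ s = some p) (n : ℕ)
    (hn : n < m) : θ (s + n) = some (p.1, p.2 + n) := by
  induction n with
  | zero => simpa using hp
  | succ n ih =>
    obtain ⟨q, hq⟩ := Option.ne_none_iff_exists'.1 (h (s + (n + 1 : ℕ)) (by omega) (by omega))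
    have := hθ.compat _ _ q (ih (by omega)) (by rw [← hq]; push_cast; ring_nf)
    rw [hq, this]
    push_cast; ring_nf

section Glue

/-- Slots of length `L` centred at multiples of `L`; good slots carry the central part of a
shape and are delimited by holes, the other positions are filled by the `0`-th point. -/
noncomputable def glue (L c : ℤ) (good : ℤ → Prop) (τ : ℤ → ℤ → Option (ℕ × ℤ)) (i : ℤ) :
    Option (ℕ × ℤ) :=
  open Classical in
  if (i + c) % L = 0 then
    if good ((i + c) / L) ∨ good ((i + c) / L - 1) then none else some (0, i)
  else if good ((i + c) / L) then τ ((i + c) / L) ((i + c) % L - c) else some (0, i)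

variable {L c : ℤ} {good : ℤ → Prop} {τ : ℤ → ℤ → Option (ℕ × ℤ)}

theorem exists_slot (hL : 0 < L) (c i : ℤ) : ∃ k r, 0 ≤ r ∧ r < L ∧ i = k * L + r - c :=
  ⟨(i + c) / L, (i + c) % L, Int.emod_nonneg _ hL.ne', Int.emod_lt_of_pos _ hL, by
    have := Int.mul_ediv_add_emod (i + c) L
    rw [mul_comm] at this
    omega⟩

theorem slot_div_mod {k r : ℤ} (h0 : 0 ≤ r) (h1 : r < L) :
    (k * L + r - c + c) / L = k ∧ (k * L + r - c + c) % L = r := by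
  have h : k * L + r - c + c = r + L * k := by ring
  rw [h, Int.add_mul_emod_self_left, Int.add_mul_ediv_left _ _ (by omega),
    Int.ediv_eq_zero_of_lt h0 h1, Int.emod_eq_of_lt h0 h1]
  simp

theorem glue_good {k r : ℤ} (h0 : 0 < r) (h1 : r < L) (hk : good k) :
    glue L c good τ (k * L + r - c) = τ k (r - c) := by
  obtain ⟨h2, h3⟩ := slot_div_mod (c := c) (k := k) h0.le h1
  rw [glue, h2, h3, if_neg h0.ne', if_pos hk]

theorem glue_not_good {k r : ℤ} (h0 : 0 < r) (h1 : r < L) (hk : ¬ good k) :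
    glue L c good τ (k * L + r - c) = some (0, k * L + r - c) := by
  obtain ⟨h2, h3⟩ := slot_div_mod (c := c) (k := k) h0.le h1
  rw [glue, h2, h3, if_neg h0.ne', if_neg hk]

theorem glue_boundary_not_good {k : ℤ} (hL : 0 < L) (hk : ¬ good k) (hk' : ¬ good (k - 1)) :
    glue L c good τ (k * L + 0 - c) = some (0, k * L + 0 - c) := by
  obtain ⟨h2, h3⟩ := slot_div_mod (c := c) (k := k) le_rfl hL
  rw [glue, h2, h3, if_pos rfl, if_neg (not_or.2 ⟨hk, hk'⟩)]

theorem glue_boundary_good {k : ℤ} (hL : 0 < L) (hk : good k ∨ good (k - 1)) :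
    glue L c good τ (k * L + 0 - c) = none := by
  obtain ⟨h2, h3⟩ := slot_div_mod (c := c) (k := k) le_rfl hL
  rw [glue, h2, h3, if_pos rfl, if_pos hk]

theorem glue_compat (hL : 2 ≤ L) (hτ : ∀ k, IsShape (τ k)) (i : ℤ) (p q : ℕ × ℤ)
    (hp : glue L c good τ i = some p) (hq : glue L c good τ (i + 1) = some q) :
    q = (p.1, p.2 + 1) := by
  obtain ⟨k, r, h0, h1, rfl⟩ := exists_slot (by omega : 0 < L) c i
  have hfill : ∀ j, some ((0 : ℕ), j) = some p → some ((0 : ℕ), j + 1) = some q →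
      q = (p.1, p.2 + 1) := by
    intro j h h'
    rw [← Option.some.inj h, ← Option.some.inj h']
  rcases h0.eq_or_lt with rfl | h0
  · have e : k * L + 0 - c + 1 = k * L + 1 - c := by ring
    by_cases hk : good k ∨ good (k - 1)
    · rw [glue_boundary_good (by omega) hk] at hp
      cases hp
    · rw [not_or] at hk
      rw [glue_boundary_not_good (by omega) hk.1 hk.2] at hp
      refine hfill _ hp ?_
      rw [e, glue_not_good one_pos (by omega) hk.1] at hq
      rwa [e]
  · rcases (by omega : r + 1 < L ∨ r + 1 = L) with h2 | h2
    · have e : k * L + r - c + 1 = k * L + (r + 1) - c := by ring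
      rw [e] at hq
      by_cases hk : good k
      · rw [glue_good h0 h1 hk] at hp
        rw [glue_good (by omega) h2 hk] at hq
        exact (hτ k).compat (r - c) p q hp (by rwa [show r - c + 1 = r + 1 - c by ring])
      · rw [glue_not_good h0 h1 hk] at hp
        rw [glue_not_good (by omega) h2 hk] at hq
        exact hfill _ hp (by rwa [e])
    · have e : k * L + r - c + 1 = (k + 1) * L + 0 - c := by rw [← h2]; ring
      rw [e] at hq
      by_cases hk : good (k + 1) ∨ good (k + 1 - 1)
      · rw [glue_boundary_good (by omega) hk] at hq
        cases hq
      · rw [not_or] at hk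
        rw [glue_boundary_not_good (by omega) hk.1 hk.2] at hq
        rw [glue_not_good h0 h1 (by simpa using hk.2)] at hp
        exact hfill _ hp (by rwa [e])

theorem glue_runs {N : ℕ} (hτ : ∀ k, IsShape (τ k))
    (htail : ∀ k (i : ℤ), N < |i| → τ k i ≠ none)
    (hgap : ∀ m : ℕ, 1 ≤ m → ∀ k : ℤ, ∃ K : ℤ, k ≤ K ∧ K ≤ k + 2 * 8 ^ m ∧
      ∀ j, K ≤ j → j < K + 2 ^ m → ¬ good j) (m : ℕ) (w : ℤ) :
    ∃ s, w ≤ s ∧ s + m ≤ w + runBound m ∧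
      ∀ i, s ≤ i → i < s + m → glue (4 * N + 2) (2 * N + 1) good τ i ≠ none := by
  rcases Nat.eq_zero_or_pos m with rfl | hm
  · exact ⟨w, le_rfl, by simp, fun i h1 h2 => by simp at h2; omega⟩
  have hpow : m * 8 ^ m ≥ m := Nat.le_mul_of_pos_right m (by positivity)
  have hrb : (runBound m : ℤ) = 17 * (m * 8 ^ m : ℕ) + 1 := by
    unfold runBound; push_cast; ring
  obtain ⟨kw, rw', hr0, hr1, rfl⟩ := exists_slot (by omega : 0 < (4 * N + 2 : ℤ)) (2 * N + 1) w
  have hint : ∀ k r : ℤ, 0 < r → r < 4 * N + 2 → N < |r - (2 * N + 1)| →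
      glue (4 * N + 2) (2 * N + 1) good τ (k * (4 * N + 2) + r - (2 * N + 1)) ≠ none := by
    intro k r h0 h1 h2
    by_cases hk : good k
    · rw [glue_good h0 h1 hk]; exact htail k _ h2
    · rw [glue_not_good h0 h1 hk]; simp
  rcases le_or_gt m N with hmN | hmN
  · have hbd : ∀ k : ℤ, kw * (4 * N + 2) + rw' ≤ k * (4 * N + 2) →
        k * (4 * N + 2) < kw * (4 * N + 2) + rw' + runBound m →
        ∃ s, kw * (4 * N + 2) + rw' - (2 * N + 1) ≤ s ∧
          s + m ≤ kw * (4 * N + 2) + rw' - (2 * N + 1) + runBound m ∧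
          ∀ i, s ≤ i → i < s + m → glue (4 * N + 2) (2 * N + 1) good τ i ≠ none := by
      intro k h1 h2
      rcases le_or_gt (kw * (4 * N + 2) + rw' + m) (k * (4 * N + 2)) with h3 | h3
      · refine ⟨k * (4 * N + 2) - (2 * N + 1) - m, by omega, by omega, fun i hi hi' => ?_⟩
        have := hint (k - 1) (i - (k - 1) * (4 * N + 2) + (2 * N + 1))
          (by rw [sub_mul]; omega) (by rw [sub_mul]; omega)
          (by rw [sub_mul, lt_abs]; omega)
        rwa [show (k - 1) * (4 * N + 2) + (i - (k - 1) * (4 * N + 2) + (2 * N + 1)) - (2 * N + 1)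
          = i by ring] at this
      · refine ⟨k * (4 * N + 2) - (2 * N + 1) + 1, by omega, by omega, fun i hi hi' => ?_⟩
        have := hint k (i - k * (4 * N + 2) + (2 * N + 1)) (by omega) (by omega)
          (by rw [lt_abs]; omega)
        rwa [show k * (4 * N + 2) + (i - k * (4 * N + 2) + (2 * N + 1)) - (2 * N + 1)
          = i by ring] at this
    rcases hr0.eq_or_lt with rfl | hr0
    · exact hbd kw (by omega) (by omega)
    rcases lt_or_ge (4 * N + 2 : ℤ) (rw' + runBound m) with h | h
    · exact hbd (kw + 1) (by rw [add_mul]; omega) (by rw [add_mul]; omega)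
    by_cases hk : good kw
    · obtain ⟨s, h1, h2, h3⟩ := (hτ kw).runs m (rw' - (2 * N + 1))
      refine ⟨kw * (4 * N + 2) + s, by omega, by omega, fun i hi hi' => ?_⟩
      have e : i = kw * (4 * N + 2) + (i - kw * (4 * N + 2) + (2 * N + 1)) - (2 * N + 1) := by
        ring
      rw [e, glue_good (by omega) (by omega) hk]
      exact h3 _ (by omega) (by omega)
    · refine ⟨kw * (4 * N + 2) + rw' - (2 * N + 1), le_rfl, by omega, fun i hi hi' => ?_⟩
      have e : i = kw * (4 * N + 2) + (i - kw * (4 * N + 2) + (2 * N + 1)) - (2 * N + 1) := by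
        ring
      rw [e, glue_not_good (by omega) (by omega) hk]
      simp
  · obtain ⟨K, hK1, hK2, hK3⟩ := hgap m hm (kw + 1)
    refine ⟨K * (4 * N + 2) + 1 - (2 * N + 1), ?_, ?_, fun i hi hi' => ?_⟩
    · nlinarith
    · have h1 : K * (4 * N + 2) ≤ (kw + 1 + 2 * 8 ^ m) * (4 * N + 2) :=
        mul_le_mul_of_nonneg_right hK2 (by omega)
      have h2 : (1 + 2 * 8 ^ m : ℤ) * (4 * N + 2) ≤ (1 + 2 * 8 ^ m) * (4 * m) :=
        mul_le_mul_of_nonneg_left (by omega) (by positivity)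
      rw [hrb]
      push_cast
      have hpow' : (m : ℤ) * 8 ^ m ≥ m := by exact_mod_cast hpow
      nlinarith
    · obtain ⟨k, r, h0, h1, rfl⟩ := exists_slot (by omega : 0 < (4 * N + 2 : ℤ)) (2 * N + 1) i
      have h2 : K ≤ k := by
        by_contra! hc
        nlinarith [mul_le_mul_of_nonneg_right (Int.add_one_le_iff.2 hc)
          (by omega : (0 : ℤ) ≤ 4 * N + 2)]
      have h3 : k < K + 2 ^ m := by
        by_contra! hc
        have hm2 : (m : ℤ) < 2 ^ m := by exact_mod_cast Nat.lt_two_pow_self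
        have := mul_le_mul_of_nonneg_right hc (by omega : (0 : ℤ) ≤ 4 * N + 2)
        nlinarith
      rcases h0.eq_or_lt with rfl | h0
      · rw [glue_boundary_not_good (by omega) (hK3 k h2 h3)]
        · simp
        · refine hK3 _ ?_ (by omega)
          by_contra! hc
          obtain rfl : k = K := by omega
          omega
      · rw [glue_not_good h0 h1 (hK3 k h2 h3)]
        simp

theorem isShape_glue {N : ℕ} (hτ : ∀ k, IsShape (τ k))
    (htail : ∀ k (i : ℤ), N < |i| → τ k i ≠ none)
    (hbound : ∃ B : ℕ, ∀ k i p, τ k i = some p → p.1 < B)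
    (hgood : ∃ M : ℕ, ∀ k, good k → 0 ≤ k ∧ k < M)
    (hgap : ∀ m : ℕ, 1 ≤ m → ∀ k : ℤ, ∃ K : ℤ, k ≤ K ∧ K ≤ k + 2 * 8 ^ m ∧
      ∀ j, K ≤ j → j < K + 2 ^ m → ¬ good j) :
    IsShape (glue (4 * N + 2) (2 * N + 1) good τ) where
  compat := glue_compat (by omega) hτ
  runs := glue_runs hτ htail hgap
  tail := by
    obtain ⟨M, hM⟩ := hgood
    refine ⟨(M + 1) * (4 * N + 2) + (2 * N + 1), fun i hi => ?_⟩
    obtain ⟨k, r, h0, h1, rfl⟩ := exists_slot (by omega : 0 < (4 * N + 2 : ℤ)) (2 * N + 1) i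
    push_cast at hi
    have hk : k < 0 ∨ M < k := by
      by_contra! hc
      have h2 := mul_nonneg hc.1 (by omega : (0 : ℤ) ≤ 4 * N + 2)
      have h3 := mul_le_mul_of_nonneg_right hc.2 (by omega : (0 : ℤ) ≤ 4 * N + 2)
      rw [lt_abs] at hi
      rcases hi with hi | hi <;> nlinarith
    have hk1 : ¬ good k := fun h => by have := hM k h; omega
    have hk2 : ¬ good (k - 1) := fun h => by have := hM _ h; omega
    rcases h0.eq_or_lt with rfl | h0
    · rw [glue_boundary_not_good (by omega) hk1 hk2]
      simp
    · rw [glue_not_good h0 h1 hk1]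
      simp
  bound := by
    obtain ⟨B, hB⟩ := hbound
    refine ⟨B + 1, fun i p hp => ?_⟩
    unfold glue at hp
    split_ifs at hp
    · rw [← Option.some.inj hp]; simp
    · exact (hB _ _ _ hp).trans (Nat.lt_succ_self _)
    · rw [← Option.some.inj hp]; simp

end Glue

/-- Slots left unused in order to create long runs without holes. -/
def IsBadSlot (k : ℕ) : Prop := ∃ v, 1 ≤ v ∧ 8 ^ v ≤ k ∧ k % 8 ^ v < 2 ^ v

open Classical in
theorem card_filter_badSlot_le (M : ℕ) :
    3 * ((Finset.range (M + 1)).filter IsBadSlot).card ≤ M := by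
  have hsub : (Finset.range (M + 1)).filter IsBadSlot ⊆
      (Finset.Ico 1 (M + 1)).biUnion fun v =>
        (Finset.range (M + 1)).filter fun k => 8 ^ v ≤ k ∧ k % 8 ^ v < 2 ^ v := by
    intro k hk
    obtain ⟨hk1, v, hv1, hv2, hv3⟩ := Finset.mem_filter.1 hk
    have hvk : v < 8 ^ v := Nat.lt_pow_self (by norm_num)
    rw [Finset.mem_range] at hk1
    exact Finset.mem_biUnion.2 ⟨v, Finset.mem_Ico.2 ⟨hv1, by omega⟩,
      Finset.mem_filter.2 ⟨Finset.mem_range.2 hk1, hv2, hv3⟩⟩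
  have hv : ∀ v ∈ Finset.Ico 1 (M + 1),
      ((Finset.range (M + 1)).filter fun k => 8 ^ v ≤ k ∧ k % 8 ^ v < 2 ^ v).card
        ≤ M / 4 ^ v := by
    intro v _
    have hinj : ((Finset.range (M + 1)).filter fun k => 8 ^ v ≤ k ∧ k % 8 ^ v < 2 ^ v).card
        ≤ (Finset.Icc 1 (M / 8 ^ v) ×ˢ Finset.range (2 ^ v)).card := by
      refine Finset.card_le_card_of_injOn (fun k => (k / 8 ^ v, k % 8 ^ v)) ?_ ?_
      · intro k hk
        obtain ⟨hk1, hk2, hk3⟩ := Finset.mem_filter.1 hk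
        rw [Finset.mem_range] at hk1
        exact Finset.mem_product.2 ⟨Finset.mem_Icc.2
          ⟨Nat.div_pos hk2 (by positivity), Nat.div_le_div_right (by omega)⟩,
          Finset.mem_range.2 hk3⟩
      · intro k _ k' _ h
        obtain ⟨h1, h2⟩ := Prod.mk.inj h
        rw [← Nat.div_add_mod k (8 ^ v), ← Nat.div_add_mod k' (8 ^ v), h1, h2]
    refine hinj.trans ?_
    rw [Finset.card_product, Nat.card_Icc, Finset.card_range, Nat.le_div_iff_mul_le (by positivity),
      Nat.add_sub_cancel, mul_assoc, ← mul_pow]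
    exact Nat.div_mul_le_self _ _
  have h := (Finset.card_le_card hsub).trans (Finset.card_biUnion_le.trans
    (Finset.sum_le_sum hv)) |>.trans (Nat.geom_sum_Ico_le (by norm_num) M (M + 1))
  omega

theorem exists_gap (S : Finset ℕ) (hS : ∀ k ∈ S, ¬ IsBadSlot k) (m : ℕ) (hm : 1 ≤ m) (k : ℤ) :
    ∃ K : ℤ, k ≤ K ∧ K ≤ k + 2 * 8 ^ m ∧
      ∀ j, K ≤ j → j < K + 2 ^ m → ¬ (0 ≤ j ∧ j.toNat ∈ S) := by
  have h8 : (0 : ℤ) < 8 ^ m := by positivity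
  have h28 : (2 : ℤ) ^ m ≤ 8 ^ m := by gcongr; norm_num
  rcases le_or_gt (k + 2 ^ m) 0 with hk | hk
  · exact ⟨k, le_rfl, by omega, fun j _ h2 h3 => by omega⟩
  obtain ⟨M, hM0, hkM, hM⟩ : ∃ M : ℤ, 0 ≤ M ∧ k ≤ M ∧ (M = k ∨ M = 0) :=
    ⟨max k 0, le_max_right _ _, le_max_left _ _, max_choice k 0⟩
  have hd := Int.mul_ediv_add_emod M (8 ^ m)
  have hd1 := Int.emod_nonneg M h8.ne'
  have hd2 := Int.emod_lt_of_pos M h8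
  have hd3 : 0 ≤ M / 8 ^ m := Int.ediv_nonneg hM0 h8.le
  refine ⟨8 ^ m * (M / 8 ^ m) + 8 ^ m, by omega, by omega, ?_⟩
  · rintro j hj1 hj2 ⟨hj3, hj4⟩
    refine hS _ hj4 ⟨m, hm, ?_, ?_⟩
    · zify
      rw [Int.toNat_of_nonneg hj3]
      have := mul_nonneg h8.le hd3
      omega
    · zify
      rw [Int.toNat_of_nonneg hj3]
      have e : j = (j - (8 ^ m * (M / 8 ^ m) + 8 ^ m)) + 8 ^ m * (M / 8 ^ m + 1) := by
        ring
      rw [e, Int.add_mul_emod_self_left, Int.emod_eq_of_lt (by omega) (by omega)]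
      omega

/-- Independent copies of the central parts of two shapes can be inserted along a set of
positions of positive density of a single shape. -/
theorem exists_glue {θ₀ θ₁ : ℤ → Option (ℕ × ℤ)} (h₀ : IsShape θ₀) (h₁ : IsShape θ₁) (N₀ : ℕ) :
    ∃ L : ℕ, 0 < L ∧ ∀ n : ℕ, ∃ G : Finset ℕ, (∀ k ∈ G, k * L ≤ n) ∧ n + 1 ≤ 2 * L * G.card ∧
      ∀ ε : ℕ → Bool, ∃ θ, IsShape θ ∧ ∀ k ∈ G, ∀ i : ℤ, |i| ≤ N₀ →
        θ (i + (k * L : ℕ)) = (if ε k then θ₁ else θ₀) i := by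
  classical
  obtain ⟨M₀, hM₀⟩ := h₀.tail
  obtain ⟨M₁, hM₁⟩ := h₁.tail
  obtain ⟨B₀, hB₀⟩ := h₀.bound
  obtain ⟨B₁, hB₁⟩ := h₁.bound
  obtain ⟨N, hN0, hN1, hN2⟩ : ∃ N, N₀ ≤ N ∧ M₀ ≤ N ∧ M₁ ≤ N :=
    ⟨N₀ + M₀ + M₁, by omega, by omega, by omega⟩
  refine ⟨4 * N + 2, by omega, fun n => ?_⟩
  refine ⟨(Finset.range (n / (4 * N + 2) + 1)).filter fun k => ¬ IsBadSlot k, ?_, ?_, ?_⟩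
  · intro k hk
    have := Finset.mem_range.1 (Finset.mem_filter.1 hk).1
    exact (Nat.le_div_iff_mul_le (by omega)).1 (by omega)
  · have h1 := card_filter_badSlot_le (n / (4 * N + 2))
    have h2 := Finset.card_filter_add_card_filter_not
      (s := Finset.range (n / (4 * N + 2) + 1)) (p := IsBadSlot)
    rw [Finset.card_range] at h2
    have h3 : n / (4 * N + 2) + 1 ≤ 2 *
      ((Finset.range (n / (4 * N + 2) + 1)).filter fun k => ¬ IsBadSlot k).card := by omega
    have h4 := Nat.lt_mul_div_succ n (by omega : 0 < 4 * N + 2)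
    calc n + 1 ≤ (4 * N + 2) * (n / (4 * N + 2) + 1) := h4
      _ ≤ (4 * N + 2) * (2 *
        ((Finset.range (n / (4 * N + 2) + 1)).filter fun k => ¬ IsBadSlot k).card) := by gcongr
      _ = _ := by ring
  · intro ε
    set G := (Finset.range (n / (4 * N + 2) + 1)).filter fun k => ¬ IsBadSlot k with hG
    refine ⟨glue (4 * N + 2) (2 * N + 1) (fun k => 0 ≤ k ∧ k.toNat ∈ G)
      (fun k => if ε k.toNat then θ₁ else θ₀), isShape_glue ?_ ?_ ?_ ?_ ?_, ?_⟩
    · intro k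
      split_ifs <;> assumption
    · intro k i hi
      split_ifs
      · exact hM₁ i (by omega)
      · exact hM₀ i (by omega)
    · refine ⟨B₀ + B₁, fun k i p hp => ?_⟩
      split_ifs at hp
      · have := hB₁ i p hp; omega
      · have := hB₀ i p hp; omega
    · refine ⟨n / (4 * N + 2) + 1, fun k hk => ⟨hk.1, ?_⟩⟩
      have := Finset.mem_range.1 (Finset.mem_filter.1 hk.2).1
      omega
    · exact exists_gap G fun k hk => (Finset.mem_filter.1 hk).2
    · intro k hk i hi
      have hi' := abs_le.1 hi
      have e : i + ((k * (4 * N + 2) : ℕ) : ℤ) =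
          (k : ℤ) * (4 * N + 2) + (i + (2 * N + 1)) - (2 * N + 1) := by
        push_cast; ring
      rw [e, glue_good (by omega) (by omega) ⟨by omega, by simpa using hk⟩]
      simp

/-- The point obtained by reading the sequence `a` along the shape `θ`, with the new symbol
at the holes. -/
def build {A : Type*} (θ : ℤ → Option (ℕ × ℤ)) (a : ℕ → ℤ → A) : ℤ → A ⊕ Fin 1 := fun i =>
  (θ i).elim (Sum.inr 0) fun p => Sum.inl (a p.1 p.2)

/-- A sequence of pairwise related points. -/
def IsClique {A : Type*} (E : Set ((ℤ → A) × (ℤ → A))) (a : ℕ → ℤ → A) : Prop :=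
  ∀ i j, (a i, a j) ∈ E

section Build

variable {A : Type*}

theorem build_shift (θ : ℤ → Option (ℕ × ℤ)) (a : ℕ → ℤ → A) (s : ℤ) :
    build (fun i => θ (i + s)) a = shiftZ s (build θ a) := rfl

theorem build_reindex (θ : ℤ → Option (ℕ × ℤ)) (a : ℕ → ℤ → A) (g : ℕ → ℕ) :
    build (fun i => (θ i).map (Prod.map g id)) a = build θ (a ∘ g) := by
  funext i
  simp only [build]
  cases θ i <;> rfl

theorem build_congr {θ : ℤ → Option (ℕ × ℤ)} {a b : ℕ → ℤ → A}
    (h : ∀ i p, θ i = some p → a p.1 = b p.1) : build θ a = build θ b := by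
  funext i
  simp only [build]
  cases hi : θ i with
  | none => rfl
  | some p => simp only [Option.elim_some, h i p hi]

theorem isShape_some (j : ℕ) : IsShape fun i => some (j, i) :=
  isShape_of_forall_some j 0 (by simp)

theorem continuous_build [TopologicalSpace A] (θ : ℤ → Option (ℕ × ℤ)) :
    Continuous (build θ : (ℕ → ℤ → A) → ℤ → A ⊕ Fin 1) := by
  refine continuous_pi fun i => ?_
  simp only [build]
  cases θ i with
  | none => exact continuous_const
  | some p => exact continuous_inl.comp ((continuous_apply p.2).comp (continuous_apply p.1))

theorem continuous_inlMap [TopologicalSpace A] (m : ℕ) :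
    Continuous (inlMap m : (ℤ → A) → ℤ → A ⊕ Fin m) :=
  continuous_pi fun i => continuous_inl.comp (continuous_apply i)

theorem IsShape.exists_reading {θ : ℤ → Option (ℕ × ℤ)} (hθ : IsShape θ) {a : ℕ → ℤ → A}
    {s : ℤ} {m : ℕ} (h : ∀ i : ℤ, |i| ≤ m → build θ a (i + s) ≠ Sum.inr 0) :
    ∃ j t, ∀ i : ℤ, |i| ≤ m → Sum.inl (shiftZ t (a j) i) = build θ a (i + s) := by
  have hrun : ∀ i, s - m ≤ i → i < s - m + (2 * m + 1 : ℕ) → θ i ≠ none := by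
    intro i h1 h2 hi
    refine h (i - s) (abs_le.2 (by omega)) ?_
    rw [sub_add_cancel, build, hi]
    rfl
  obtain ⟨p, hp⟩ := Option.ne_none_iff_exists'.1 (hrun (s - m) le_rfl (by omega))
  refine ⟨p.1, p.2 + m, fun i hi => ?_⟩
  rw [abs_le] at hi
  have h1 := hθ.eq_some_add hrun hp (i + m).toNat (by omega)
  rw [Int.toNat_of_nonneg (by omega), show s - m + (i + m) = i + s by ring] at h1
  rw [build, h1]
  simp only [shiftZ, Option.elim_some]
  congr 2; ring

end Build

section Closed

theorem isClosed_exists {α β : Type*} [TopologicalSpace α] [TopologicalSpace β] [CompactSpace β]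
    {S : Set (α × β)} (hS : IsClosed S) : IsClosed {a | ∃ b, (a, b) ∈ S} := by
  have : {a | ∃ b, (a, b) ∈ S} = Prod.fst '' S := by ext; simp
  rw [this]
  exact isClosedMap_fst_of_compactSpace _ hS

theorem isClopen_window {D : Type*} [TopologicalSpace D] [DiscreteTopology D] (S : ℤ → Set D)
    (s : ℤ) (m : ℕ) : IsClopen {y : ℤ → D | ∀ i : ℤ, |i| ≤ m → y (i + s) ∈ S i} := by
  have : {y : ℤ → D | ∀ i : ℤ, |i| ≤ m → y (i + s) ∈ S i} =
      ⋂ i ∈ Finset.Icc (-m : ℤ) m, {y | y (i + s) ∈ S i} := by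
    ext y; simp [abs_le]
  rw [this]
  exact isClopen_biInter_finset fun i _ => isClopen_coord _ _

theorem isClosed_agree {A T : Type*} [TopologicalSpace A] [TopologicalSpace T]
    [DiscreteTopology A] {f : T → ℤ → A} {g : T → ℤ → A ⊕ Fin 1} (hf : Continuous f)
    (hg : Continuous g) (s : ℤ) (m : ℕ) :
    IsClosed {t | ∀ i : ℤ, |i| ≤ m → Sum.inl (f t i) = g t (i + s)} := by
  simp only [ofPred_forall]
  exact isClosed_iInter fun i => isClosed_iInter fun _ =>
    isClosed_eq (continuous_inl.comp ((continuous_apply i).comp hf))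
      ((continuous_apply (i + s)).comp hg)

end Closed

/-- A closed, doubly shift-invariant, symmetric relation, reflexive on its domain. -/
structure IsShiftRel {A : Type*} [TopologicalSpace A] (E : Set ((ℤ → A) × (ℤ → A))) : Prop where
  closed : IsClosed E
  symm : ∀ p ∈ E, (p.2, p.1) ∈ E
  refl : ∀ p ∈ E, (p.1, p.1) ∈ E
  inv : ∀ p ∈ E, ∀ m n : ℤ, (shiftZ m p.1, shiftZ n p.2) ∈ E

section Space

variable {A : Type*} [TopologicalSpace A]

/-- The subshift whose entropy pairs realize `E`. -/
def spaceOf (E : Set ((ℤ → A) × (ℤ → A))) : Set (ℤ → A ⊕ Fin 1) :=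
  closure {y | ∃ θ a, IsShape θ ∧ IsClique E a ∧ y = build θ a}

/-- Closure of the pairs of points built from a common clique. -/
def relOf (E : Set ((ℤ → A) × (ℤ → A))) : Set ((ℤ → A ⊕ Fin 1) × (ℤ → A ⊕ Fin 1)) :=
  closure {p | ∃ θ θ' a, IsShape θ ∧ IsShape θ' ∧ IsClique E a ∧ p = (build θ a, build θ' a)}

/-- Closure of the pairs of a built point and a shift of a member of its clique. -/
def readOf (E : Set ((ℤ → A) × (ℤ → A))) : Set ((ℤ → A ⊕ Fin 1) × (ℤ → A)) :=
  closure {p | ∃ θ a s j, IsShape θ ∧ IsClique E a ∧ p = (build θ a, shiftZ s (a j))}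

variable {E : Set ((ℤ → A) × (ℤ → A))}

theorem build_mem_spaceOf {θ : ℤ → Option (ℕ × ℤ)} {a : ℕ → ℤ → A} (hθ : IsShape θ)
    (ha : IsClique E a) : build θ a ∈ spaceOf E :=
  subset_closure ⟨θ, a, hθ, ha, rfl⟩

theorem build_mem_relOf {θ θ' : ℤ → Option (ℕ × ℤ)} {a : ℕ → ℤ → A} (hθ : IsShape θ)
    (hθ' : IsShape θ') (ha : IsClique E a) : (build θ a, build θ' a) ∈ relOf E :=
  subset_closure ⟨θ, θ', a, hθ, hθ', ha, rfl⟩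

theorem build_mem_readOf {θ : ℤ → Option (ℕ × ℤ)} {a : ℕ → ℤ → A} (hθ : IsShape θ)
    (ha : IsClique E a) (s : ℤ) (j : ℕ) : (build θ a, shiftZ s (a j)) ∈ readOf E :=
  subset_closure ⟨θ, a, s, j, hθ, ha, rfl⟩

theorem spaceOf_subset {S : Set (ℤ → A ⊕ Fin 1)} (hS : IsClosed S)
    (h : ∀ θ a, IsShape θ → IsClique E a → build θ a ∈ S) : spaceOf E ⊆ S :=
  closure_minimal (by rintro _ ⟨θ, a, hθ, ha, rfl⟩; exact h θ a hθ ha) hS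

theorem relOf_subset {S : Set ((ℤ → A ⊕ Fin 1) × (ℤ → A ⊕ Fin 1))} (hS : IsClosed S)
    (h : ∀ θ θ' a, IsShape θ → IsShape θ' → IsClique E a → (build θ a, build θ' a) ∈ S) :
    relOf E ⊆ S :=
  closure_minimal (by rintro _ ⟨θ, θ', a, hθ, hθ', ha, rfl⟩; exact h θ θ' a hθ hθ' ha) hS

theorem readOf_subset {S : Set ((ℤ → A ⊕ Fin 1) × (ℤ → A))} (hS : IsClosed S)
    (h : ∀ θ a s j, IsShape θ → IsClique E a → (build θ a, shiftZ s (a j)) ∈ S) :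
    readOf E ⊆ S :=
  closure_minimal (by rintro _ ⟨θ, a, s, j, hθ, ha, rfl⟩; exact h θ a s j hθ ha) hS

theorem isClosed_spaceOf : IsClosed (spaceOf E) := isClosed_closure

theorem isClosed_relOf : IsClosed (relOf E) := isClosed_closure

theorem isClosed_readOf : IsClosed (readOf E) := isClosed_closure

theorem relOf_subset_prod : relOf E ⊆ spaceOf E ×ˢ spaceOf E :=
  relOf_subset (isClosed_spaceOf.prod isClosed_spaceOf) fun _ _ _ hθ hθ' ha =>
    ⟨build_mem_spaceOf hθ ha, build_mem_spaceOf hθ' ha⟩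

theorem fst_mem_spaceOf {p : (ℤ → A ⊕ Fin 1) × (ℤ → A)} (hp : p ∈ readOf E) :
    p.1 ∈ spaceOf E :=
  readOf_subset (S := Prod.fst ⁻¹' spaceOf E) (isClosed_spaceOf.preimage continuous_fst)
    (fun _ _ _ _ hθ ha => build_mem_spaceOf hθ ha) hp

theorem shift_mem_relOf {z : ℤ → A ⊕ Fin 1} (hz : z ∈ spaceOf E) (s t : ℤ) :
    (shiftZ s z, shiftZ t z) ∈ relOf E :=
  spaceOf_subset (S := (fun z => (shiftZ s z, shiftZ t z)) ⁻¹' relOf E)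
    (isClosed_relOf.preimage ((continuous_shiftZ s).prodMk (continuous_shiftZ t)))
    (fun _ _ hθ ha => build_mem_relOf (hθ.shift s) (hθ.shift t) ha) hz

theorem shift_mem_spaceOf {z : ℤ → A ⊕ Fin 1} (hz : z ∈ spaceOf E) (s : ℤ) :
    shiftZ s z ∈ spaceOf E :=
  (relOf_subset_prod (shift_mem_relOf hz s s)).1

theorem isSubshift_spaceOf : IsSubshift (spaceOf E) := by
  refine ⟨isClosed_spaceOf, Subset.antisymm ?_ fun z hz => ?_⟩
  · rintro _ ⟨z, hz, rfl⟩
    exact shift_mem_spaceOf hz 1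
  · exact ⟨shiftZ (-1) z, shift_mem_spaceOf hz (-1), by
      funext i; simp [shiftMap, shiftZ]⟩

theorem inlMap_mem_spaceOf {x : ℤ → A} (hx : (x, x) ∈ E) : inlMap 1 x ∈ spaceOf E :=
  build_mem_spaceOf (isShape_some 0) (a := fun _ => x) fun _ _ => hx

theorem inlMap_mem_readOf {x : ℤ → A} (hx : (x, x) ∈ E) : (inlMap 1 x, x) ∈ readOf E := by
  have := build_mem_readOf (isShape_some 0) (a := fun _ => x) (E := E) (fun _ _ => hx) 0 0
  rwa [shiftZ_zero] at this

theorem inlMap_mem_relOf (hE : IsShiftRel E) :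
    ∀ p ∈ E, Prod.map (inlMap 1) (inlMap 1) p ∈ relOf E := by
  rintro ⟨x, y⟩ h
  refine build_mem_relOf (isShape_some 0) (isShape_some 1)
    (a := fun n => if n = 0 then x else y) fun i j => ?_
  dsimp only
  split_ifs
  · exact hE.refl _ h
  · exact h
  · exact hE.symm _ h
  · exact hE.refl _ (hE.symm _ h)

section Compact

variable [Finite A]

theorem exists_common_read (hE : IsShiftRel E) {p : (ℤ → A ⊕ Fin 1) × (ℤ → A ⊕ Fin 1)}
    (h : p ∈ relOf E) : ∃ c, (p.1, c) ∈ readOf E ∧ (p.2, c) ∈ readOf E ∧ (c, c) ∈ E := by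
  have hQ : IsClosed {p : (ℤ → A ⊕ Fin 1) × (ℤ → A ⊕ Fin 1) | ∃ c, (p, c) ∈
      {t : ((ℤ → A ⊕ Fin 1) × (ℤ → A ⊕ Fin 1)) × (ℤ → A) |
        (t.1.1, t.2) ∈ readOf E ∧ (t.1.2, t.2) ∈ readOf E ∧ (t.2, t.2) ∈ E}} :=
    isClosed_exists ((isClosed_readOf.preimage (by fun_prop)).inter
      ((isClosed_readOf.preimage (by fun_prop)).inter (hE.closed.preimage (by fun_prop))))
  exact relOf_subset hQ (fun θ θ' a hθ hθ' ha => ⟨shiftZ 0 (a 0), build_mem_readOf hθ ha _ _,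
    build_mem_readOf hθ' ha _ _, hE.inv _ (ha 0 0) 0 0⟩) h

theorem exists_base_point {y : ℤ → A ⊕ Fin 1} (hE : IsShiftRel E) (h : y ∈ spaceOf E) :
    ∃ x, (x, x) ∈ E ∧ (y, inlMap 1 x) ∈ relOf E ∧ (inlMap 1 x, y) ∈ relOf E := by
  have hi := continuous_inlMap (A := A) 1
  have hQ : IsClosed {y : ℤ → A ⊕ Fin 1 | ∃ x, (y, x) ∈ {t : (ℤ → A ⊕ Fin 1) × (ℤ → A) |
      (t.2, t.2) ∈ E ∧ (t.1, inlMap 1 t.2) ∈ relOf E ∧ (inlMap 1 t.2, t.1) ∈ relOf E}} :=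
    isClosed_exists ((hE.closed.preimage (by fun_prop)).inter
      ((isClosed_relOf.preimage (by fun_prop)).inter (isClosed_relOf.preimage (by fun_prop))))
  exact spaceOf_subset hQ (fun θ a hθ ha => ⟨a 0, ha 0 0,
    build_mem_relOf hθ (isShape_some 0) ha, build_mem_relOf (isShape_some 0) hθ ha⟩) h

end Compact

section Discrete

variable [DiscreteTopology A]

theorem EP_spaceOf : EP (spaceOf E) = relOf E := by
  apply Subset.antisymm
  · rintro ⟨y, y'⟩ (h | h)
    · obtain ⟨-, -, hne, hpos⟩ := h
      dsimp only at hne hpos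
      by_contra hR
      obtain ⟨U₀, V₀, hU₀, hV₀, hyU₀, hyV₀, hUV₀⟩ :=
        isOpen_prod_iff.1 isClosed_relOf.isOpen_compl y y' hR
      obtain ⟨U₁, V₁, hU₁, hV₁, hyU₁, hyV₁, hUV₁⟩ := t2_separation hne
      obtain ⟨U, hU, hUc, hUs⟩ := exists_mem_nhds_isClosed_subset
        (inter_mem (hU₀.mem_nhds hyU₀) (hU₁.mem_nhds hyU₁))
      obtain ⟨V, hV, hVc, hVs⟩ := exists_mem_nhds_isClosed_subset
        (inter_mem (hV₀.mem_nhds hyV₀) (hV₁.mem_nhds hyV₁))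
      refine (hpos U V hUc hVc (mem_nhdsWithin_of_mem_nhds hU) (mem_nhdsWithin_of_mem_nhds hV)
        (hUV₁.mono (fun _ h => (hUs h).2) fun _ h => (hVs h).2)).not_ge
        (coverEntropy_nonpos fun z hz => ?_)
      by_contra! hc
      obtain ⟨⟨n, hn⟩, k, hk⟩ := hc
      rw [notMem_compl_iff, shiftMap_iterate] at hn hk
      exact hUV₀ (mk_mem_prod (hUs hn).1 (hVs hk).1) (shift_mem_relOf hz n k)
    · obtain ⟨hy, rfl : y = y'⟩ := h
      have := shift_mem_relOf hy 0 0
      rwa [shiftZ_zero] at this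
  · refine relOf_subset (isClosed_EP isClosed_spaceOf) fun θ θ' a hθ hθ' ha => ?_
    by_cases hne : build θ a = build θ' a
    · exact Or.inr ⟨build_mem_spaceOf hθ ha, hne⟩
    refine Or.inl ⟨build_mem_spaceOf hθ ha, build_mem_spaceOf hθ' ha, hne,
      fun U V _ _ hU hV hUV => ?_⟩
    obtain ⟨N, hN⟩ := exists_agree_mem hU
    obtain ⟨N', hN'⟩ := exists_agree_mem hV
    obtain ⟨L, hL, h⟩ := exists_glue hθ hθ' (max N N')
    refine coverEntropy_pos hUV hL fun n => ?_
    obtain ⟨G, hG, hcard, hε⟩ := h n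
    refine ⟨G, hG, hcard, fun ε => ?_⟩
    obtain ⟨ρ, hρ, hρG⟩ := hε ε
    refine ⟨build ρ a, build_mem_spaceOf hρ ha, fun k hk => ?_⟩
    rw [shiftMap_iterate, ← build_shift]
    have hmem := build_mem_spaceOf (hρ.shift (k * L : ℕ)) ha
    split_ifs with hεk
    · refine hN' _ hmem fun i hi => ?_
      have := hρG k hk i (hi.trans (by simp))
      rw [if_pos hεk] at this
      simp only [build, this]
    · refine hN _ hmem fun i hi => ?_
      have := hρG k hk i (hi.trans (by simp))
      rw [if_neg hεk] at this
      simp only [build, this]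

theorem exists_run {y : ℤ → A ⊕ Fin 1} (hy : y ∈ spaceOf E) (m : ℕ) :
    ∃ s : ℤ, ∀ i : ℤ, |i| ≤ m → y (i + s) ≠ Sum.inr 0 := by
  have hc : IsClosed (⋃ s ∈ Finset.Icc (0 : ℤ) (m + runBound (2 * m + 1)),
      {y : ℤ → A ⊕ Fin 1 | ∀ i : ℤ, |i| ≤ m → y (i + s) ∈ ({Sum.inr 0}ᶜ : Set _)}) :=
    isClosed_biUnion_finset fun s _ => (isClopen_window (fun _ => {Sum.inr 0}ᶜ) s m).isClosed
  have := spaceOf_subset (E := E) hc (fun θ a hθ _ => ?_) hy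
  · simp only [mem_iUnion] at this
    obtain ⟨s, -, hs⟩ := this
    exact ⟨s, hs⟩
  · obtain ⟨s, h1, h2, h3⟩ := hθ.runs (2 * m + 1) 0
    simp only [mem_iUnion]
    refine ⟨s + m, Finset.mem_Icc.2 (by omega), fun i hi => ?_⟩
    rw [abs_le] at hi
    obtain ⟨p, hp⟩ := Option.ne_none_iff_exists'.1 (h3 (i + (s + m)) (by omega) (by omega))
    simp [build, hp]

variable [Finite A]

theorem exists_rel_agree (hE : IsShiftRel E) {y : ℤ → A ⊕ Fin 1} {c : ℤ → A}
    (h : (y, c) ∈ readOf E) {s : ℤ} {m : ℕ} (hs : ∀ i : ℤ, |i| ≤ m → y (i + s) ≠ Sum.inr 0) :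
    ∃ d, (c, d) ∈ E ∧ ∀ i : ℤ, |i| ≤ m → Sum.inl (d i) = y (i + s) := by
  have hW : IsClopen {p : (ℤ → A ⊕ Fin 1) × (ℤ → A) |
      ∀ i : ℤ, |i| ≤ m → p.1 (i + s) ∈ ({Sum.inr 0}ᶜ : Set _)} :=
    (isClopen_window (fun _ => {Sum.inr 0}ᶜ) s m).preimage continuous_fst
  have hQ : IsClosed {p : (ℤ → A ⊕ Fin 1) × (ℤ → A) |
      ∃ d, (p, d) ∈ {t : ((ℤ → A ⊕ Fin 1) × (ℤ → A)) × (ℤ → A) |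
        (t.1.2, t.2) ∈ E ∧ ∀ i : ℤ, |i| ≤ m → Sum.inl (t.2 i) = t.1.1 (i + s)}} :=
    isClosed_exists ((hE.closed.preimage (by fun_prop)).inter
      (isClosed_agree continuous_snd (by fun_prop) s m))
  have := readOf_subset (E := E) (hW.compl.isClosed.union hQ) (fun θ a t j hθ ha => ?_) h
  · exact this.resolve_left fun h => h hs
  · by_cases hr : ∀ i : ℤ, |i| ≤ m → build θ a (i + s) ≠ Sum.inr 0
    · obtain ⟨j', t', h'⟩ := hθ.exists_reading hr
      exact Or.inr ⟨shiftZ t' (a j'), hE.inv _ (ha j j') t t', h'⟩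
    · exact Or.inl hr

theorem exists_read_agree {y : ℤ → A ⊕ Fin 1} (h : y ∈ spaceOf E) {m : ℕ}
    (hs : ∀ i : ℤ, |i| ≤ m → y i ≠ Sum.inr 0) :
    ∃ d, (y, d) ∈ readOf E ∧ ∀ i : ℤ, |i| ≤ m → Sum.inl (d i) = y i := by
  have hQ : IsClosed {y : ℤ → A ⊕ Fin 1 |
      ∃ d, (y, d) ∈ {t : (ℤ → A ⊕ Fin 1) × (ℤ → A) |
        t ∈ readOf E ∧ ∀ i : ℤ, |i| ≤ m → Sum.inl (t.2 i) = t.1 (i + 0)}} :=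
    isClosed_exists (isClosed_readOf.inter (isClosed_agree continuous_snd continuous_fst 0 m))
  have := spaceOf_subset (E := E)
    ((isClopen_window (fun _ => {Sum.inr 0}ᶜ) 0 m).compl.isClosed.union hQ) (fun θ a hθ ha => ?_) h
  · simpa using this.resolve_left fun h => h (by simpa using hs)
  · by_cases hr : ∀ i : ℤ, |i| ≤ m → build θ a (i + 0) ≠ Sum.inr 0
    · obtain ⟨j', t', h'⟩ := hθ.exists_reading hr
      exact Or.inr ⟨shiftZ t' (a j'), build_mem_readOf hθ ha _ _, h'⟩
    · exact Or.inl hr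

theorem mem_of_inlMap_mem_relOf (hE : IsShiftRel E) {x x' : ℤ → A}
    (h : (inlMap 1 x, inlMap 1 x') ∈ relOf E) : (x, x') ∈ E := by
  rw [← hE.closed.closure_eq]
  refine mem_closure_of_agree fun m => ?_
  have hW : ∀ q : (ℤ → A ⊕ Fin 1) × (ℤ → A ⊕ Fin 1) → ℤ → A ⊕ Fin 1, Continuous q →
      IsClopen {p | ∀ i : ℤ, |i| ≤ m → q p (i + 0) ∈ ({Sum.inr 0}ᶜ : Set _)} :=
    fun q hq => (isClopen_window (fun _ => {Sum.inr 0}ᶜ) 0 m).preimage hq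
  have hQ : IsClosed {p : (ℤ → A ⊕ Fin 1) × (ℤ → A ⊕ Fin 1) |
      ∃ d, (p, d) ∈ {t : ((ℤ → A ⊕ Fin 1) × (ℤ → A ⊕ Fin 1)) × ((ℤ → A) × (ℤ → A)) |
        t.2 ∈ E ∧ (∀ i : ℤ, |i| ≤ m → Sum.inl (t.2.1 i) = t.1.1 (i + 0)) ∧
          ∀ i : ℤ, |i| ≤ m → Sum.inl (t.2.2 i) = t.1.2 (i + 0)}} :=
    isClosed_exists ((hE.closed.preimage continuous_snd).inter
      ((isClosed_agree (by fun_prop) (by fun_prop) 0 m).inter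
        (isClosed_agree (by fun_prop) (by fun_prop) 0 m)))
  have := relOf_subset (E := E) (((hW _ continuous_fst).compl.isClosed.union
    (hW _ continuous_snd).compl.isClosed).union hQ) (fun θ θ' a hθ hθ' ha => ?_) h
  · obtain ⟨d, hd, h1, h2⟩ := this.resolve_left
      (not_or.2 ⟨fun h => h (by simp [inlMap]), fun h => h (by simp [inlMap])⟩)
    exact ⟨d, hd, fun i hi => ⟨by simpa [inlMap] using h1 i hi, by simpa [inlMap] using h2 i hi⟩⟩
  · by_cases hr : ∀ i : ℤ, |i| ≤ m → build θ a (i + 0) ≠ Sum.inr 0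
    · by_cases hr' : ∀ i : ℤ, |i| ≤ m → build θ' a (i + 0) ≠ Sum.inr 0
      · obtain ⟨j, t, h⟩ := hθ.exists_reading hr
        obtain ⟨j', t', h'⟩ := hθ'.exists_reading hr'
        exact Or.inr ⟨(shiftZ t (a j), shiftZ t' (a j')), hE.inv _ (ha j j') t t', h, h'⟩
      · exact Or.inl (Or.inr hr')
    · exact Or.inl (Or.inl hr)

/-- All readings of a point are related by the transitive closure of `E`. -/
theorem transClosure_of_reads (hE : IsShiftRel E) {y : ℤ → A ⊕ Fin 1} {c c' : ℤ → A}
    (h : (y, c) ∈ readOf E) (h' : (y, c') ∈ readOf E) : (c, c') ∈ transClosure E := by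
  let K : ℕ → Set ((ℤ → A) × (ℤ → A)) := fun m =>
    {p | ((c, p.1) ∈ E ∧ (c', p.2) ∈ E) ∧ ∀ i : ℤ, |i| ≤ m → p.1 i = p.2 i}
  have hK : ∀ m, IsClosed (K m) := by
    intro m
    refine ((hE.closed.preimage (by fun_prop)).inter (hE.closed.preimage (by fun_prop))).inter ?_
    change IsClosed {p : (ℤ → A) × (ℤ → A) | ∀ i : ℤ, |i| ≤ m → p.1 i = p.2 i}
    simp only [ofPred_forall]
    exact isClosed_iInter fun i => isClosed_iInter fun _ =>
      isClosed_eq (by fun_prop) (by fun_prop)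
  obtain ⟨⟨d, d'⟩, hd⟩ : (⋂ m, K m).Nonempty := by
    refine IsCompact.nonempty_iInter_of_sequence_nonempty_isCompact_isClosed K ?_ ?_
      (hK 0).isCompact hK
    · exact fun m p hp => ⟨hp.1, fun i hi => hp.2 i (hi.trans (by simp))⟩
    · intro m
      obtain ⟨s, hs⟩ := exists_run (fst_mem_spaceOf h) m
      obtain ⟨d, hd, hds⟩ := exists_rel_agree hE h hs
      obtain ⟨d', hd', hds'⟩ := exists_rel_agree hE h' hs
      exact ⟨(d, d'), ⟨hd, hd'⟩, fun i hi => Sum.inl_injective ((hds i hi).trans (hds' i hi).symm)⟩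
  rw [mem_iInter] at hd
  have hdd : d = d' := by
    funext i
    exact (hd i.natAbs).2 i (by rw [Int.abs_eq_natAbs])
  subst hdd
  exact transClosure_trans (subset_transClosure _ (hd 0).1.1)
    (subset_transClosure _ (hE.symm _ (hd 0).1.2))

end Discrete

end Space

section CloseUpOfSpace

variable {A : Type u} [TopologicalSpace A] {E : Set ((ℤ → A) × (ℤ → A))}

theorem subset_closeUp {α : Type u} [TopologicalSpace α] (F : Set (α × α)) (o : Ordinal.{u}) :
    F ⊆ closeUp F o := by
  have := closeUp_mono F (a := 0) (b := o) zero_le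
  rwa [closeUp_zero] at this

theorem closeUp_relOf_subset_prod (o : Ordinal.{u}) :
    closeUp (relOf E) o ⊆ spaceOf E ×ˢ spaceOf E :=
  closeUp_subset_prod isClosed_spaceOf relOf_subset_prod o

theorem build_mem_closeUp_relOf (hE : IsShiftRel E) {o : Ordinal.{u}} (ho : o % 2 = 0)
    {θ θ' : ℤ → Option (ℕ × ℤ)} (hθ : IsShape θ) (hθ' : IsShape θ') {b b' : ℕ → ℤ → A}
    (hb : IsClique E b) (hb' : IsClique E b') (h : ∀ i j, (b i, b' j) ∈ closeUp E o) :
    (build θ b, build θ' b') ∈ closeUp (relOf E) o := by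
  by_cases h0 : o = 0
  · subst h0
    rw [closeUp_zero] at h ⊢
    have hcl : IsClique E fun n => if n % 2 = 0 then b (n / 2) else b' (n / 2) := by
      intro i j
      dsimp only
      split_ifs
      · exact hb _ _
      · exact h _ _
      · exact hE.symm _ (h _ _)
      · exact hb' _ _
    have := build_mem_relOf (hθ.reindex fun n => 2 * n) (hθ'.reindex fun n => 2 * n + 1) hcl
    rw [build_reindex, build_reindex] at this
    convert this using 3
    · funext n; simp
    · funext n
      have h1 : (2 * n + 1) % 2 = 1 := by omega
      have h2 : (2 * n + 1) / 2 = n := by omega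
      simp [h1, h2]
  · have h1 : (inlMap 1 (b 0), inlMap 1 (b' 0)) ∈ closeUp (relOf E) o :=
      closeUp_map (continuous_inlMap 1) (inlMap_mem_relOf hE) o _ (h 0 0)
    refine closeUp_trans_of_even ho h0 (subset_closeUp _ o ?_)
      (closeUp_trans_of_even ho h0 h1 (subset_closeUp _ o ?_))
    · exact build_mem_relOf hθ (isShape_some 0) hb
    · exact build_mem_relOf (isShape_some 0) hθ' hb'

theorem prod_subset_of_isClosed {S : Set ((ℤ → A ⊕ Fin 1) × (ℤ → A ⊕ Fin 1))} (hS : IsClosed S)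
    (h : ∀ θ θ' a a', IsShape θ → IsShape θ' → IsClique E a → IsClique E a' →
      (build θ a, build θ' a') ∈ S) : spaceOf E ×ˢ spaceOf E ⊆ S := by
  rw [spaceOf, ← closure_prod_eq]
  refine closure_minimal ?_ hS
  rintro ⟨_, _⟩ ⟨⟨θ, a, hθ, ha, rfl⟩, θ', a', hθ', ha', rfl⟩
  exact h θ θ' a a' hθ hθ' ha ha'

theorem prod_subset_closeUp_of_odd (hE : IsShiftRel E) {o : Ordinal.{u}} (ho : o % 2 = 0)
    (h : ∀ k : ℕ, 1 ≤ k →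
      pairSet E k ⊆ closure (relPow (closeUp E o) (k + k) ∩ pairSet E k)) :
    spaceOf E ×ˢ spaceOf E ⊆ closeUp (relOf E) (o + 1) := by
  rw [closeUp_add_one_of_even _ ho]
  refine prod_subset_of_isClosed isClosed_closure fun θ θ' a a' hθ hθ' ha ha' => ?_
  obtain ⟨k₀, hk₀⟩ := hθ.bound
  obtain ⟨k₁, hk₁⟩ := hθ'.bound
  let k := k₀ + k₁ + 1
  let ι : ℕ → Fin k := fun j => if hj : j < k then ⟨j, hj⟩ else ⟨0, Nat.succ_pos _⟩
  have hι : ∀ j < k, (ι j : ℕ) = j := fun j hj => by simp only [ι, dif_pos hj]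
  let Φ : (Fin (k + k) → ℤ → A) → (ℤ → A ⊕ Fin 1) × (ℤ → A ⊕ Fin 1) := fun w =>
    (build θ fun j => w (Fin.castAdd k (ι j)), build θ' fun j => w (Fin.natAdd k (ι j)))
  have hΦ : Continuous Φ :=
    ((continuous_build θ).comp (continuous_pi fun j => continuous_apply _)).prodMk
      ((continuous_build θ').comp (continuous_pi fun j => continuous_apply _))
  have hw : Fin.append (fun j : Fin k => a j) (fun j : Fin k => a' j) ∈ pairSet E k :=
    ⟨_, fun _ _ => ha _ _, _, fun _ _ => ha' _ _, rfl⟩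
  have hmap := map_mem_closure (t := closeUp (relOf E) o) hΦ (h k (Nat.succ_pos _) hw) ?_
  · convert hmap using 1
    simp only [Φ, Fin.append_left, Fin.append_right]
    rw [Prod.mk.injEq]
    refine ⟨build_congr fun i p hp => ?_, build_congr fun i p hp => ?_⟩
    · rw [hι _ (by have := hk₀ i p hp; omega)]
    · rw [hι _ (by have := hk₁ i p hp; omega)]
  · rintro w ⟨hw1, u, hu, v, hv, rfl⟩
    refine build_mem_closeUp_relOf hE ho hθ hθ' ?_ ?_ fun i j => hw1 _ _
    · intro i j
      simp only [Fin.append_left]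
      exact hu _ _
    · intro i j
      simp only [Fin.append_right]
      exact hv _ _

variable [Finite A]

theorem prod_subset_closeUp_of_even (hE : IsShiftRel E) {o : Ordinal.{u}} (ho : o % 2 = 0)
    (h : ∀ x x', (x, x) ∈ E → (x', x') ∈ E → (x, x') ∈ closeUp E o) :
    spaceOf E ×ˢ spaceOf E ⊆ closeUp (relOf E) o := by
  by_cases h0 : o = 0
  · have hcl : IsClosed (closeUp (relOf E) o) := by
      rw [h0, closeUp_zero]; exact isClosed_relOf
    exact prod_subset_of_isClosed hcl fun θ θ' a a' hθ hθ' ha ha' =>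
      build_mem_closeUp_relOf hE ho hθ hθ' ha ha' fun i j => h _ _ (ha i i) (ha' j j)
  · rintro ⟨y, y'⟩ ⟨hy, hy'⟩
    obtain ⟨x, hx, hyx, -⟩ := exists_base_point hE hy
    obtain ⟨x', hx', -, hyx'⟩ := exists_base_point hE hy'
    exact closeUp_trans_of_even ho h0 (subset_closeUp _ o hyx) (closeUp_trans_of_even ho h0
      (closeUp_map (continuous_inlMap 1) (inlMap_mem_relOf hE) o _ (h x x' hx hx'))
      (subset_closeUp _ o hyx'))

variable [DiscreteTopology A]

theorem exists_reads_of_mem_closeUp (hE : IsShiftRel E) (o : Ordinal.{u}) :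
    ∀ p ∈ closeUp (relOf E) o, ∃ c, (p, c) ∈
      {t : ((ℤ → A ⊕ Fin 1) × (ℤ → A ⊕ Fin 1)) × ((ℤ → A) × (ℤ → A)) |
        (t.1.1, t.2.1) ∈ readOf E ∧ (t.1.2, t.2.2) ∈ readOf E ∧ t.2 ∈ closeUp E o} := by
  induction o using Ordinal.limitRecOn with
  | zero =>
    intro p hp
    rw [closeUp_zero] at hp
    obtain ⟨c, h1, h2, h3⟩ := exists_common_read hE hp
    exact ⟨(c, c), h1, h2, subset_closeUp _ _ h3⟩
  | add_one o ih =>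
    rcases ordinal_mod_two o with ho | ho
    · rw [closeUp_add_one_of_even _ ho, closeUp_add_one_of_even _ ho]
      refine closure_minimal (fun p hp => ?_) (isClosed_exists
        ((isClosed_readOf.preimage (by fun_prop)).inter
          ((isClosed_readOf.preimage (by fun_prop)).inter
            (isClosed_closure.preimage (by fun_prop)))))
      obtain ⟨c, h1, h2, h3⟩ := ih p hp
      exact ⟨c, h1, h2, subset_closure h3⟩
    · rw [closeUp_add_one_of_odd _ ho, closeUp_add_one_of_odd _ ho]
      rintro ⟨y, y'⟩ hp
      change Relation.TransGen _ y y' at hp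
      induction hp with
      | single h =>
        obtain ⟨c, h1, h2, h3⟩ := ih _ h
        exact ⟨c, h1, h2, subset_transClosure _ h3⟩
      | tail _ h ih' =>
        obtain ⟨⟨c₁, c₂⟩, h1, h2, h3⟩ := ih'
        obtain ⟨⟨c₃, c₄⟩, h4, h5, h6⟩ := ih _ h
        exact ⟨(c₁, c₄), h1, h5, transClosure_trans h3 (transClosure_trans
          (transClosure_mono (subset_closeUp E o) (transClosure_of_reads hE h2 h4))
          (subset_transClosure _ h6))⟩
  | limit o ho ih =>
    intro p hp
    rw [closeUp_limit _ ho] at hp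
    obtain ⟨⟨γ, hγ⟩, hp⟩ := mem_iUnion.1 hp
    obtain ⟨c, h1, h2, h3⟩ := ih γ hγ p hp
    exact ⟨c, h1, h2, closeUp_mono _ (le_of_lt hγ) h3⟩

theorem mem_closeUp_of_reads (hE : IsShiftRel E) {o : Ordinal.{u}} (ho : o % 2 = 0) (h0 : o ≠ 0)
    {y y' : ℤ → A ⊕ Fin 1} (hy : (y, y') ∈ closeUp (relOf E) o) {c c' : ℤ → A}
    (hc : (y, c) ∈ readOf E) (hc' : (y', c') ∈ readOf E) : (c, c') ∈ closeUp E o := by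
  obtain ⟨⟨d, d'⟩, h1, h2, h3⟩ := exists_reads_of_mem_closeUp hE o _ hy
  have hsub : transClosure E ⊆ closeUp E o :=
    (transClosure_mono (subset_closeUp E o)).trans (transClosure_closeUp_of_even E ho h0)
  exact closeUp_trans_of_even ho h0 (hsub (transClosure_of_reads hE hc h1))
    (closeUp_trans_of_even ho h0 h3 (hsub (transClosure_of_reads hE h2 hc')))

theorem mem_closeUp_of_inlMap (hE : IsShiftRel E) (o : Ordinal.{u}) {x x' : ℤ → A}
    (hx : (x, x) ∈ E) (hx' : (x', x') ∈ E)
    (h : (inlMap 1 x, inlMap 1 x') ∈ closeUp (relOf E) o) : (x, x') ∈ closeUp E o := by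
  have heven : ∀ o : Ordinal.{u}, o % 2 = 0 → o ≠ 0 →
      (inlMap 1 x, inlMap 1 x') ∈ closeUp (relOf E) o → (x, x') ∈ closeUp E o :=
    fun o ho h0 h => mem_closeUp_of_reads hE ho h0 h (inlMap_mem_readOf hx) (inlMap_mem_readOf hx')
  induction o using Ordinal.limitRecOn with
  | zero =>
    rw [closeUp_zero] at h ⊢
    exact mem_of_inlMap_mem_relOf hE h
  | add_one o _ =>
    rcases ordinal_mod_two o with ho | ho
    · by_cases h0 : o = 0
      · subst h0
        rw [closeUp_add_one_of_even _ ho, closeUp_zero, isClosed_relOf.closure_eq] at h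
        exact subset_closeUp _ _ (mem_of_inlMap_mem_relOf hE h)
      rw [closeUp_add_one_of_even _ ho] at h ⊢
      refine mem_closure_of_agree fun m => ?_
      have hW : ∀ z : ℤ → A, IsOpen {y : ℤ → A ⊕ Fin 1 |
          ∀ i : ℤ, |i| ≤ m → y (i + 0) ∈ ({Sum.inl (z i)} : Set _)} :=
        fun z => (isClopen_window _ 0 m).isOpen
      obtain ⟨⟨y, y'⟩, ⟨hyx, hyx'⟩, hy⟩ := mem_closure_iff.1 h _ ((hW x).prod (hW x'))
        ⟨by simp [inlMap], by simp [inlMap]⟩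
      simp only [mem_ofPred_eq, add_zero, mem_singleton_iff] at hyx hyx'
      have hY := closeUp_relOf_subset_prod o hy
      obtain ⟨d, hd, hdy⟩ := exists_read_agree (m := m) hY.1 fun i hi => by simp [hyx i hi]
      obtain ⟨d', hd', hdy'⟩ := exists_read_agree (m := m) hY.2 fun i hi => by simp [hyx' i hi]
      exact ⟨(d, d'), mem_closeUp_of_reads hE ho h0 hy hd hd', fun i hi =>
        ⟨Sum.inl_injective ((hdy i hi).trans (hyx i hi)),
          Sum.inl_injective ((hdy' i hi).trans (hyx' i hi))⟩⟩
    · have hodd := add_one_mod_two_of_odd ho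
      exact heven _ hodd (Order.succ_ne_bot o) h
  | limit o ho _ => exact heven o (mod_two_of_isSuccLimit ho) ho.ne_bot h

end CloseUpOfSpace

end CPE

open CPE in
/-- Let `X ⊆ A^ℤ` be a zero-entropy subshift and `E ⊆ X²` a closed, doubly shift-invariant,
symmetric, reflexive relation.  Then there is a finite alphabet `Â ⊇ A` (w.l.o.g.
`Â = A ⊕ Fin m`) and a subshift `Y` with `X ⊆ Y ⊆ Â^ℤ` such that
`EP(Y)^(λ) ∩ X² = E^(λ)` for all ordinals `λ` (identifying `X` with its copy in `Â^ℤ`).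
Moreover, if `E^(λ) = X²`, then `EP(Y)^(λ+1) = Y²`, and already `EP(Y)^(λ) = Y²` provided
`λ` is even, or `λ` is odd (hence a successor `μ + 1`) and for all `k ≥ 1`,
`(E^[k])² ⊆ closure ((E^(λ-1))^[2k] ∩ (E^[k])²)`. -/
theorem relations_as_entropy_pairs_with_process
    {A : Type} [Fintype A] [TopologicalSpace A] [DiscreteTopology A]
    (X : Set (ℤ → A)) (hX : IsSubshift X) (hXzero : HasZeroEntropy X)
    (E : Set ((ℤ → A) × (ℤ → A))) (hEX : E ⊆ X ×ˢ X) (hEclosed : IsClosed E)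
    (hEsym : ∀ p ∈ E, (p.2, p.1) ∈ E) (hErefl : ∀ x ∈ X, (x, x) ∈ E)
    (hEinv : ∀ p ∈ E, ∀ m n : ℤ, (shiftZ m p.1, shiftZ n p.2) ∈ E) :
    ∃ (m : ℕ) (Y : Set (ℤ → A ⊕ Fin m)), IsSubshift Y ∧ inlMap m '' X ⊆ Y ∧
      (∀ lam : Ordinal, closeUp (EP Y) lam ∩ ((inlMap m '' X) ×ˢ (inlMap m '' X))
          = Prod.map (inlMap m) (inlMap m) '' closeUp E lam) ∧
      (∀ lam : Ordinal, closeUp E lam = X ×ˢ X →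
        closeUp (EP Y) (lam + 1) = Y ×ˢ Y ∧
        (lam % 2 = 0 → closeUp (EP Y) lam = Y ×ˢ Y) ∧
        (lam % 2 = 1 →
          (∀ mu : Ordinal, lam = mu + 1 → ∀ k : ℕ, 1 ≤ k →
            pairSet E k ⊆ closure (relPow (closeUp E mu) (k + k) ∩ pairSet E k)) →
          closeUp (EP Y) lam = Y ×ˢ Y)) := by
  have hE : IsShiftRel E := ⟨hEclosed, hEsym, fun p hp => hErefl _ (hEX hp).1, hEinv⟩
  have hsub : ∀ o : Ordinal.{0}, closeUp E o ⊆ X ×ˢ X := closeUp_subset_prod hX.1 hEX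
  have hmem : ∀ x, (x, x) ∈ E → x ∈ X := fun x hx => (hEX hx).1
  have hEP : EP (spaceOf E) = relOf E := EP_spaceOf
  have heven : ∀ o : Ordinal.{0}, o % 2 = 0 → closeUp E o = X ×ˢ X →
      closeUp (EP (spaceOf E)) o = spaceOf E ×ˢ spaceOf E := by
    intro o ho h
    rw [hEP]
    refine Subset.antisymm (closeUp_relOf_subset_prod o)
      (prod_subset_closeUp_of_even hE ho fun x x' hx hx' => ?_)
    rw [h]
    exact ⟨hmem x hx, hmem x' hx'⟩
  refine ⟨1, spaceOf E, isSubshift_spaceOf, ?_, fun o => ?_, fun o ho => ⟨?_, fun h => heven o h ho,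
    fun hodd happ => ?_⟩⟩
  · rintro _ ⟨x, hx, rfl⟩
    exact inlMap_mem_spaceOf (hErefl x hx)
  · rw [hEP]
    apply Subset.antisymm
    · rintro ⟨_, _⟩ ⟨h, ⟨x, hx, rfl⟩, x', hx', rfl⟩
      exact ⟨(x, x'), mem_closeUp_of_inlMap hE o (hErefl x hx) (hErefl x' hx') h, rfl⟩
    · rintro _ ⟨p, hp, rfl⟩
      exact ⟨closeUp_map (continuous_inlMap 1) (inlMap_mem_relOf hE) o p hp,
        mem_image_of_mem _ (hsub o hp).1, mem_image_of_mem _ (hsub o hp).2⟩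
  · have hsucc : closeUp (EP (spaceOf E)) (o + 1) ⊆ spaceOf E ×ˢ spaceOf E := by
      rw [hEP]
      exact closeUp_relOf_subset_prod _
    rcases ordinal_mod_two o with h | h
    · refine Subset.antisymm hsucc ?_
      rw [← heven o h ho]
      exact closeUp_subset_add_one _ _
    · refine heven _ (add_one_mod_two_of_odd h) (Subset.antisymm (hsub _) ?_)
      rw [← ho]
      exact closeUp_subset_add_one _ _
  · have hpred : ∃ mu : Ordinal.{0}, o = mu + 1 ∧ mu % 2 = 0 := by
      refine ⟨2 * (o / 2), ?_, Ordinal.mul_mod _ _⟩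
      have := Ordinal.div_add_mod o 2
      rw [hodd] at this
      exact this.symm
    obtain ⟨mu, rfl, hmu⟩ := hpred
    rw [hEP]
    exact Subset.antisymm (closeUp_relOf_subset_prod _)
      (prod_subset_closeUp_of_odd hE hmu (happ mu rfl))
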